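/- Let d ≥ 1 and let β_1, β_2, …, β_d, β_{d+2}, …, β_{2d} be fixed positive numbers, and let M ≥ 15d+5. Then there exists ε ∈ (0,1), depending on these numbers, such that if β_{1+d} is chosen with 0 < β_{1+d} ≤ ε, the random walk in the i.i.d. Dirichlet environment with parameters (β_1, …, β_{2d}) satisfies condition (P)_M in direction e_1 on a box of size L ≥ c_0. -/

import Mathlib

open MeasureTheory Filter Topology
open scoped ENNReal NNReal Classical BigOperators

namespace RWRE

/-- Sites of the lattice `ℤ^d`. -/
abbrev V (d : ℕ) := Fin d → ℤ

/-- The `2d` canonical unit vectors: `dir d i = e_{i+1}` for `i < d`, and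
`dir d i = -e_{i-d+1}` for `d ≤ i < 2d`. -/
def dir (d : ℕ) (i : Fin (2 * d)) : V d :=
  fun j => if (j : ℕ) = (i : ℕ) ∨ (j : ℕ) + d = (i : ℕ) then (if (i : ℕ) < d then 1 else -1) else 0

/-- The index of the direction opposite to direction `i`. -/
def opp {d : ℕ} (i : Fin (2 * d)) : Fin (2 * d) :=
  ⟨if (i : ℕ) < d then (i : ℕ) + d else (i : ℕ) - d, by have := i.isLt; split <;> omega⟩

/-- The set `𝒫` of probability vectors on the `2d` directions. -/
abbrev Simplex (d : ℕ) := {p : Fin (2 * d) → ℝ // (∀ i, 0 ≤ p i) ∧ ∑ i, p i = 1}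

/-- The environment space `Ω = 𝒫^{ℤ^d}`. -/
abbrev Env (d : ℕ) := V d → Simplex d

/-- The space of trajectories of the walk. -/
abbrev Traj (d : ℕ) := ℕ → V d

/-- Transition probability of the walk from `y` to `z` in environment `ω`. -/
noncomputable def trans (d : ℕ) (ω : Env d) (y z : V d) : ℝ :=
  ∑ i : Fin (2 * d), if z = y + dir d i then (ω y).1 i else 0

/-- `Pq` is the family of quenched laws: `Pq ω x` is a probability measure on trajectories,
starting at `x`, whose cylinder probabilities are given by the products of the transition
probabilities of the environment `ω`. -/
def IsQuenchedLaw (d : ℕ) (Pq : Env d → V d → Measure (Traj d)) : Prop :=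
  (∀ ω x, IsProbabilityMeasure (Pq ω x)) ∧
  ∀ (ω : Env d) (x : V d) (n : ℕ) (σ : ℕ → V d),
    (Pq ω x {f | ∀ k ≤ n, f k = σ k}).toReal =
      (if σ 0 = x then 1 else 0) * ∏ k ∈ Finset.range n, trans d ω (σ k) (σ (k + 1))

/-- The annealed (averaged) law `P_x = ∫ P_{x,ω} dℙ`. -/
noncomputable def annealed (d : ℕ) (ℙ : Measure (Env d)) (Pq : Env d → V d → Measure (Traj d))
    (x : V d) : Measure (Traj d) :=
  ℙ.bind (fun ω => Pq ω x)

/-- `{ω(x) : x ∈ ℤ^d}` are i.i.d. under `ℙ`, with one-site marginal `μ`. -/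
def IsIIDWith (d : ℕ) (ℙ : Measure (Env d)) (μ : Measure (Simplex d)) : Prop :=
  IsProbabilityMeasure ℙ ∧ IsProbabilityMeasure μ ∧
  ∀ (s : Finset (V d)) (A : V d → Set (Simplex d)), (∀ x, MeasurableSet (A x)) →
    ℙ {ω | ∀ x ∈ s, ω x ∈ A x} = ∏ x ∈ s, μ (A x)

/-- `{ω(x) : x ∈ ℤ^d}` are i.i.d. under `ℙ`. -/
def IsIID (d : ℕ) (ℙ : Measure (Env d)) : Prop :=
  ∃ μ : Measure (Simplex d), IsIIDWith d ℙ μ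

/-- `ℙ` is elliptic. -/
def IsElliptic (d : ℕ) (ℙ : Measure (Env d)) : Prop :=
  ∀ (x : V d) (i : Fin (2 * d)), ℙ {ω | 0 < (ω x).1 i} = 1

/-- First exit time from a set `A` (with value `0` by convention if the walk never leaves `A`). -/
noncomputable def exitTime (d : ℕ) (A : Set (V d)) (f : Traj d) : ℕ :=
  sInf {n | f n ∉ A}

/-- The coordinates of a site, as a real vector. -/
def toR (d : ℕ) (x : V d) : Fin d → ℝ := fun j => (x j : ℝ)

/-- Euclidean inner product of a site with a real vector `l`. -/
noncomputable def dotl (d : ℕ) (l : Fin d → ℝ) (x : V d) : ℝ :=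
  ∑ j, (x j : ℝ) * l j

/-- The first canonical basis vector `e_1` of `ℝ^d`. -/
def e1 (d : ℕ) : Fin d → ℝ := fun j => if (j : ℕ) = 0 then 1 else 0

/-- `R` is a rotation of `ℝ^d`: a linear automorphism preserving the Euclidean inner
product, with determinant one. -/
def IsRotation (d : ℕ) (R : (Fin d → ℝ) ≃ₗ[ℝ] (Fin d → ℝ)) : Prop :=
  (∀ u v : Fin d → ℝ, ∑ j, R u j * R v j = ∑ j, u j * v j) ∧
    LinearMap.det (R : (Fin d → ℝ) →ₗ[ℝ] (Fin d → ℝ)) = 1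

/-- The box `B_{l,L,L̃} = R((-L,L) × (-L̃,L̃)^{d-1}) ∩ ℤ^d`, where `R` is a rotation
with `R e_1 = l`. -/
def box (d : ℕ) (R : (Fin d → ℝ) ≃ₗ[ℝ] (Fin d → ℝ)) (L Lt : ℝ) : Set (V d) :=
  {x | ∀ j : Fin d,
    if (j : ℕ) = 0 then -L < R.symm (toR d x) j ∧ R.symm (toR d x) j < L
    else -Lt < R.symm (toR d x) j ∧ R.symm (toR d x) j < Lt}

/-- The polynomial condition `(P)_M` in direction `l` on a box of size `L`. -/
def PolyCond (d : ℕ) (ℙ : Measure (Env d)) (Pq : Env d → V d → Measure (Traj d))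
    (l : Fin d → ℝ) (M L : ℝ) : Prop :=
  ∃ Lt : ℝ, 0 < Lt ∧ Lt ≤ 70 * L ^ 3 ∧
  ∃ R : (Fin d → ℝ) ≃ₗ[ℝ] (Fin d → ℝ), IsRotation d R ∧ R (e1 d) = l ∧
    ((annealed d ℙ Pq 0) {f | dotl d l (f (exitTime d (box d R L Lt) f)) < L}).toReal ≤ 1 / L ^ M

/-- The quantity `η_α = max_{e ∈ U} 𝔼[ω(0,e)^{-α}]`. -/
noncomputable def eta (d : ℕ) (ℙ : Measure (Env d)) (α : ℝ) : ℝ≥0∞ :=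
  ⨆ i : Fin (2 * d), ∫⁻ ω, ENNReal.ofReal ((ω 0).1 i ^ (-α)) ∂ℙ

/-- `ᾱ = sup{α ≥ 0 : η_α < ∞}`. -/
noncomputable def alphaBar (d : ℕ) (ℙ : Measure (Env d)) : ℝ :=
  sSup {α : ℝ | 0 ≤ α ∧ eta d ℙ α < ⊤}

/-- The constant `c_0 = (2/3)·3^{120d⁴ + 3000d(log η_{ᾱ/2})²}`. -/
noncomputable def c0 (d : ℕ) (ℙ : Measure (Env d)) : ℝ :=
  (2 / 3) * (3 : ℝ) ^ (120 * (d : ℝ) ^ 4 +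
    3000 * (d : ℝ) * (Real.log (eta d ℙ (alphaBar d ℙ / 2)).toReal) ^ 2)

/-- The ellipticity condition `(E')_β`. -/
def CondE (d : ℕ) (ℙ : Measure (Env d)) (β : ℝ) : Prop :=
  ∃ α : Fin (2 * d) → ℝ, (∀ i, 0 < α i) ∧
    (∀ i, 2 * (∑ j, α j) - (α i + α (opp i)) > β) ∧
    ∀ i : Fin (2 * d),
      ∫⁻ ω, ∏ j ∈ Finset.univ.erase i, ENNReal.ofReal ((ω 0).1 j ^ (-(α j))) ∂ℙ < ⊤


/-- First `n` with `P n`, as an extended natural number (`⊤` if there is none). -/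
noncomputable def firstTime (P : ℕ → Prop) : ℕ∞ :=
  if ∃ n, P n then ((sInf {n | P n} : ℕ) : ℕ∞) else ⊤

/-- The triple `(S_k, R_k, M_k)` of the regeneration construction in direction `l`
with parameter `a`. -/
noncomputable def SR (d : ℕ) (l : Fin d → ℝ) (a : ℝ) (f : Traj d) : ℕ → ℕ∞ × ℕ∞ × ℝ
  | 0 => (0, 0, dotl d l (f 0))
  | (k + 1) =>
      let M := (SR d l a f k).2.2
      let S : ℕ∞ := firstTime fun n => M + a ≤ dotl d l (f n)
      let s : ℕ := S.toNat
      let R : ℕ∞ := if S = ⊤ then ⊤ else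
        S + firstTime fun n => dotl d l (f (s + n)) < dotl d l (f s)
      let M' : ℝ := sSup {r : ℝ | ∃ n : ℕ, (n : ℕ∞) ≤ R ∧ r = dotl d l (f n)}
      (S, R, M')

/-- The first regeneration time `τ_1` in direction `l` with parameter `a`. -/
noncomputable def tau1 (d : ℕ) (l : Fin d → ℝ) (a : ℝ) (f : Traj d) : ℕ∞ :=
  if _h : ∃ k : ℕ, 1 ≤ k ∧ (SR d l a f k).1 ≠ ⊤ ∧ (SR d l a f k).2.1 = ⊤ then
    (SR d l a f (sInf {k : ℕ | 1 ≤ k ∧ (SR d l a f k).1 ≠ ⊤ ∧ (SR d l a f k).2.1 = ⊤})).1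
  else ⊤

/-- The event `τ_1 > u` for a real threshold `u`. -/
def tau1Gt (d : ℕ) (l : Fin d → ℝ) (a : ℝ) (u : ℝ) : Set (Traj d) :=
  {f | ∀ k : ℕ, tau1 d l a f = (k : ℕ∞) → u < (k : ℝ)}

/-- `v` is the asymptotic direction of the walk under the law `P0`:
`X_n/|X_n|₂ → v` almost surely. -/
def HasAsympDir (d : ℕ) (P0 : Measure (Traj d)) (v : Fin d → ℝ) : Prop :=
  ∀ᵐ f ∂P0, Tendsto
    (fun n => fun j : Fin d => (f n j : ℝ) / Real.sqrt (∑ j', ((f n j' : ℝ)) ^ 2))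
    atTop (𝓝 v)

/-- `γ` is the centered Gaussian measure on `ι → ℝ` with covariance matrix `C`:
every linear functional pushes it forward to a one-dimensional centered Gaussian with
the corresponding variance. -/
def IsCenteredGaussian {ι : Type*} [Fintype ι] (γ : Measure (ι → ℝ)) (C : ι → ι → ℝ) : Prop :=
  ∀ u : ι → ℝ, γ.map (fun x => ∑ i, u i * x i) =
    ProbabilityTheory.gaussianReal 0 (Real.toNNReal (∑ i, ∑ j, u i * C i j * u j))

/-- `ε^{1/2}(X_{⌊ε⁻¹n⌋} - ⌊ε⁻¹n⌋ v)` converges in law under `P0`, as `ε → 0`, to a Brownian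
motion with non-degenerate covariance matrix `C`: the finite-dimensional distributions at any
times `t : Fin k → ℕ` converge weakly to the centered Gaussian with covariance
`min(t_p, t_q)·C`. -/
def CLTtoBM (d : ℕ) (P0 : Measure (Traj d)) (v : Fin d → ℝ)
    (Cmat : Matrix (Fin d) (Fin d) ℝ) : Prop :=
  ∀ (k : ℕ) (t : Fin k → ℕ),
    ∃ γ : Measure (Fin k × Fin d → ℝ), IsProbabilityMeasure γ ∧
      IsCenteredGaussian γ (fun p q => (min (t p.1) (t q.1) : ℝ) * Cmat p.2 q.2) ∧
      ∀ g : BoundedContinuousFunction ((Fin k × Fin d) → ℝ) ℝ,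
        Tendsto (fun ε : ℝ =>
            ∫ f : Traj d, g (fun p =>
              Real.sqrt ε * ((f (⌊(t p.1 : ℝ) / ε⌋₊) p.2 : ℝ) - (⌊(t p.1 : ℝ) / ε⌋₊ : ℝ) * v p.2))
              ∂P0)
          (𝓝[>] (0 : ℝ)) (𝓝 (∫ x, g x ∂γ))

/-- `μ` is the Dirichlet distribution with parameters `β` on the simplex, characterized by
its (joint polynomial) moments. -/
def IsDirichlet (d : ℕ) (μ : Measure (Simplex d)) (β : Fin (2 * d) → ℝ) : Prop :=
  IsProbabilityMeasure μ ∧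
  ∀ k : Fin (2 * d) → ℕ,
    ∫ p, ∏ i, (p.1 i) ^ (k i) ∂μ =
      (Real.Gamma (∑ i, β i) / Real.Gamma ((∑ i, β i) + (∑ i, (k i : ℝ)))) *
        ∏ i, (Real.Gamma (β i + k i) / Real.Gamma (β i))

/-! ### Directed graph structure on `ℤ^d` and flows -/

/-- Directed nearest-neighbour edges of `ℤ^d`: the pair `(z, i)` represents the edge from
`z` to `z + dir d i`. -/
abbrev Edge (d : ℕ) := V d × Fin (2 * d)

def tail (d : ℕ) (e : Edge d) : V d := e.1

def head (d : ℕ) (e : Edge d) : V d := e.1 + dir d e.2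

/-- Divergence of an edge function at a vertex. -/
noncomputable def divg (d : ℕ) (θ : Edge d → ℝ) (v : V d) : ℝ :=
  (∑ᶠ e ∈ {e : Edge d | tail d e = v}, θ e) - ∑ᶠ e ∈ {e : Edge d | head d e = v}, θ e

/-- `θ` is a flow from `A` to `Z` on the directed graph `(ℤ^d, E_{ℤ^d})`. -/
def IsFlow (d : ℕ) (θ : Edge d → ℝ) (A Z : Set (V d)) : Prop :=
  (∀ e, 0 ≤ θ e) ∧ (∀ v, v ∉ A ∪ Z → divg d θ v = 0) ∧
    (∀ v ∈ A, 0 ≤ divg d θ v) ∧ (∀ v ∈ Z, divg d θ v ≤ 0)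

/-- `θ` is a unit flow from `A` to `Z`. -/
def IsUnitFlow (d : ℕ) (θ : Edge d → ℝ) (A Z : Set (V d)) : Prop :=
  IsFlow d θ A Z ∧ ∑ᶠ v ∈ A, divg d θ v = 1


/-- Rising factorial. -/
noncomputable def rf (x : ℝ) : ℕ → ℝ
  | 0 => 1
  | (k + 1) => rf x k * (x + k)

/-- Coefficients of the binomial series of `(1-x)^{-α}`. -/
noncomputable def cf (α : ℝ) : ℕ → ℝ
  | 0 => 1
  | (k + 1) => cf α k * ((α + k) / (k + 1))

lemma rf_pos {x : ℝ} (hx : 0 < x) (k : ℕ) : 0 < rf x k := by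
  induction k with
  | zero => simp [rf]
  | succ k ih => simp only [rf]; positivity

lemma rf_nonneg {x : ℝ} (hx : 0 ≤ x) (k : ℕ) : 0 ≤ rf x k := by
  induction k with
  | zero => simp [rf]
  | succ k ih => simp only [rf]; positivity

lemma cf_nonneg {x : ℝ} (hx : 0 ≤ x) (k : ℕ) : 0 ≤ cf x k := by
  induction k with
  | zero => simp [cf]
  | succ k ih => simp only [cf]; positivity

lemma cf_eq (a : ℝ) (n : ℕ) : Ring.choose (a + n - 1) n = cf a n := by
  have h1 : Ring.choose (a + n - 1) n = Ring.multichoose a n := by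
    rw [Ring.choose]; congr 1; ring
  rw [h1]
  have h2 : ∀ n : ℕ, (n.factorial : ℝ) * Ring.multichoose a n = (ascPochhammer ℝ n).eval a := by
    intro n
    rw [← nsmul_eq_mul, Ring.factorial_nsmul_multichoose_eq_ascPochhammer,
      Polynomial.ascPochhammer_smeval_eq_eval]
  induction n with
  | zero => simp [cf]
  | succ n ih =>
    have ih := ih (by rw [Ring.choose]; congr 1; ring)
    have e1 := h2 n
    have e2 := h2 (n + 1)
    rw [ascPochhammer_succ_eval, ← e1, Nat.factorial_succ] at e2
    have hn : (n.factorial : ℝ) ≠ 0 := by positivity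
    have hn1 : (n + 1 : ℝ) ≠ 0 := by positivity
    simp only [cf]
    rw [← ih]
    push_cast at e2
    field_simp
    apply mul_left_cancel₀ hn
    linarith

lemma hasSum_cf (a : ℝ) {x : ℝ} (hx0 : 0 ≤ x) (hx1 : x < 1) :
    HasSum (fun k => cf a k * x ^ k) ((1 - x) ^ (-a)) := by
  have h := (Real.one_div_one_sub_rpow_hasFPowerSeriesOnBall_zero a).hasSum (y := x) (by
    simp [abs_of_nonneg hx0, enorm_eq_nnnorm]
    rw [← NNReal.coe_lt_coe]; simpa [abs_of_nonneg hx0] using hx1)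
  simp only [zero_add] at h
  rw [Real.rpow_neg (by linarith), ← one_div]
  have e : (fun k => cf a k * x ^ k) = fun n => (FormalMultilinearSeries.ofScalars ℝ
      (fun n : ℕ => Ring.choose (a + n - 1) n) n) fun _ => x := by
    ext k
    rw [FormalMultilinearSeries.ofScalars_apply_eq, cf_eq]
    simp
  rw [e]
  exact h

lemma harm {S : ℝ} (hS : 0 < S) (C : ℝ) : ∃ N : ℕ, C ≤ ∑ k ∈ Finset.range N, 1 / (S + k) := by
  have h := (Real.tendsto_sum_range_one_div_nat_succ_atTop.eventually_ge_atTop (C * (S + 1))).exists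
  obtain ⟨N, hN⟩ := h
  refine ⟨N, ?_⟩
  have : (∑ k ∈ Finset.range N, 1 / ((k : ℝ) + 1)) * (1 / (S + 1)) ≤
      ∑ k ∈ Finset.range N, 1 / (S + k) := by
    rw [Finset.sum_mul]
    apply Finset.sum_le_sum
    intro k _
    rw [div_mul_div_comm, mul_one]
    apply one_div_le_one_div_of_le (by positivity)
    nlinarith [mul_nonneg hS.le (Nat.cast_nonneg (α := ℝ) k)]
  refine le_trans ?_ this
  rw [mul_one_div, le_div_iff₀ (by positivity)]
  exact hN

section beta
variable {X : Type*} [MeasurableSpace X] {ν : Measure X} [IsProbabilityMeasure ν]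
  {p : X → ℝ} {β S : ℝ}

lemma beta_int (hp : Measurable p) (h0 : ∀ x, 0 ≤ p x) (h1 : ∀ x, p x ≤ 1) (j k : ℕ) :
    Integrable (fun x => p x ^ j * (1 - p x) ^ k) ν := by
  apply Integrable.of_bound (C := 1)
  · exact ((hp.pow_const j).mul ((measurable_const.sub hp).pow_const k)).aestronglyMeasurable
  · refine ae_of_all _ fun x => ?_
    have a1 : 0 ≤ 1 - p x := by linarith [h1 x]
    rw [Real.norm_of_nonneg (mul_nonneg (pow_nonneg (h0 x) _) (pow_nonneg a1 _))]
    exact mul_le_one₀ (pow_le_one₀ (h0 x) (h1 x)) (pow_nonneg a1 _)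
      (pow_le_one₀ a1 (by linarith [h0 x]))

lemma beta_mom (hp : Measurable p) (h0 : ∀ x, 0 ≤ p x) (h1 : ∀ x, p x ≤ 1)
    (hS : 0 < S) (hm : ∀ k : ℕ, ∫ x, p x ^ k ∂ν = rf β k / rf S k) (k : ℕ) :
    ∀ j : ℕ, ∫ x, p x ^ j * (1 - p x) ^ k ∂ν = rf β j * rf (S - β) k / rf S (j + k) := by
  induction k with
  | zero => intro j; simpa [rf] using hm j
  | succ k ih =>
    intro j
    have e : ∀ x, p x ^ j * (1 - p x) ^ (k + 1) =
        p x ^ j * (1 - p x) ^ k - p x ^ (j + 1) * (1 - p x) ^ k := by intro x; ring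
    simp only [e]
    rw [integral_sub (beta_int hp h0 h1 j k) (beta_int hp h0 h1 (j + 1) k), ih j, ih (j + 1)]
    have e2 : j + 1 + k = (j + k) + 1 := by ring
    have e3 : j + (k + 1) = (j + k) + 1 := by ring
    rw [e2, e3]
    simp only [rf]
    have := (rf_pos hS (j + k)).ne'
    have h3 : S + ((j + k : ℕ) : ℝ) ≠ 0 := by positivity
    field_simp
    push_cast
    ring

lemma beta_pos_ae (hp : Measurable p) (h0 : ∀ x, 0 ≤ p x) (h1 : ∀ x, p x ≤ 1)
    (hS : 0 < S) (hβ : 0 < β) (hβS : β ≤ S)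
    (hm : ∀ k : ℕ, ∫ x, p x ^ k ∂ν = rf β k / rf S k) : ∀ᵐ x ∂ν, 0 < p x := by
  set g : ℕ → ℝ := fun k => rf (S - β) k / rf S k with hg
  have hms : MeasurableSet {x | p x = 0} := hp (measurableSet_singleton 0)
  have hq : ∀ k, ν.real {x | p x = 0} ≤ g k := by
    intro k
    have := beta_mom hp h0 h1 hS hm k 0
    simp only [pow_zero, one_mul, rf, zero_add] at this
    rw [hg]; simp only; rw [← this, ← integral_indicator_one hms]
    apply integral_mono
    · exact (integrable_const (1 : ℝ)).indicator hms
    · simpa using beta_int (ν := ν) hp h0 h1 0 k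
    · intro x
      by_cases hx : p x = 0
      · simp [Set.indicator, hx]
      · simp only [Set.indicator, Set.mem_ofPred_eq, hx, if_false]
        exact pow_nonneg (by linarith [h1 x]) _
  have hsum : ∀ N, ∑ k ∈ Finset.range N, g k * (β / (S + k)) = 1 - g N := by
    intro N
    induction N with
    | zero => simp [hg, rf]
    | succ N ih =>
      rw [Finset.sum_range_succ, ih]
      simp only [hg, rf]
      have := (rf_pos hS N).ne'
      have h3 : S + (N : ℝ) ≠ 0 := by positivity
      field_simp
      ring
  by_contra hcon
  have hq0 : 0 < ν.real {x | p x = 0} := by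
    rw [measureReal_def, ENNReal.toReal_pos_iff]
    refine ⟨?_, measure_lt_top _ _⟩
    rw [pos_iff_ne_zero]
    intro hz
    apply hcon
    rw [ae_iff]
    convert hz using 2
    ext x
    simp only [Set.mem_ofPred_eq, not_lt]
    exact ⟨fun h => le_antisymm h (h0 x), fun h => h.le⟩
  set q := ν.real {x | p x = 0}
  obtain ⟨N, hN⟩ := harm hS (2 / (q * β))
  have h4 : q * β * ∑ k ∈ Finset.range N, 1 / (S + k) ≤ 1 := by
    calc q * β * ∑ k ∈ Finset.range N, 1 / (S + k)
        ≤ ∑ k ∈ Finset.range N, g k * (β / (S + k)) := by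
          rw [Finset.mul_sum]
          apply Finset.sum_le_sum
          intro k _
          have : q * β * (1 / (S + k)) = q * (β / (S + k)) := by ring
          rw [this]
          exact mul_le_mul_of_nonneg_right (hq k) (by positivity)
      _ = 1 - g N := hsum N
      _ ≤ 1 := by linarith [hq N]
  have h5 : q * β * (2 / (q * β)) = 2 := by field_simp
  have := mul_le_mul_of_nonneg_left hN (by positivity : 0 ≤ q * β)
  linarith

lemma beta_partial (hp : Measurable p) (h0 : ∀ x, 0 ≤ p x) (h1 : ∀ x, p x ≤ 1)
    (hS : 0 < S) (hm : ∀ k : ℕ, ∫ x, p x ^ k ∂ν = rf β k / rf S k) (α : ℝ) (j N : ℕ) :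
    ∫ x, p x ^ j * ∑ k ∈ Finset.range N, cf α k * (1 - p x) ^ k ∂ν =
      ∑ k ∈ Finset.range N, cf α k * (rf β j * rf (S - β) k / rf S (j + k)) := by
  simp only [Finset.mul_sum]
  rw [integral_finsetSum]
  · apply Finset.sum_congr rfl
    intro k _
    rw [← beta_mom hp h0 h1 hS hm k j, ← integral_const_mul]
    congr 1; ext x; ring
  · intro k _
    have := (beta_int (ν := ν) hp h0 h1 j k).const_mul (cf α k)
    refine this.congr (ae_of_all _ fun x => ?_)
    simp only; ring

lemma partial_le (α : ℝ) (hα : 0 ≤ α) {y : ℝ} (hy0 : 0 < y) (hy1 : y ≤ 1) (N : ℕ) :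
    ∑ k ∈ Finset.range N, cf α k * (1 - y) ^ k ≤ y ^ (-α) := by
  have h := hasSum_cf α (x := 1 - y) (by linarith) (by linarith)
  rw [sub_sub_cancel] at h
  exact sum_le_hasSum _ (fun k _ => mul_nonneg (cf_nonneg hα k) (pow_nonneg (by linarith) _)) h

lemma beta_diverge (hp : Measurable p) (h0 : ∀ x, 0 ≤ p x) (h1 : ∀ x, p x ≤ 1)
    (hS : 0 < S) (hβ : 0 < β) (hβS : β < S)
    (hm : ∀ k : ℕ, ∫ x, p x ^ k ∂ν = rf β k / rf S k) {α : ℝ} (hα : β ≤ α) :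
    ∫⁻ x, ENNReal.ofReal (p x ^ (-α)) ∂ν = ⊤ := by
  have hpos := beta_pos_ae hp h0 h1 hS hβ hβS.le hm
  set t : ℕ → ℝ := fun k => cf β k * (rf (S - β) k / rf S k) with ht
  have htpos : ∀ k, 0 ≤ t k := fun k => mul_nonneg (cf_nonneg hβ.le k)
    (div_nonneg (rf_nonneg (by linarith) k) (rf_pos hS k).le)
  have ht1 : t 1 = β * (S - β) / S := by simp [ht, cf, rf, mul_div_assoc]
  have hlow : ∀ k : ℕ, t 1 ≤ (k + 1 : ℕ) * t (k + 1) := by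
    intro k
    induction k with
    | zero => simp
    | succ k ih =>
      refine ih.trans ?_
      have e : t (k + 1 + 1) = t (k + 1) *
          ((β + (k + 1 : ℕ)) * (S - β + (k + 1 : ℕ)) / ((S + (k + 1 : ℕ)) * ((k + 1 : ℕ) + 1))) := by
        simp only [ht]
        have c1 : cf β (k + 1 + 1) = cf β (k + 1) * ((β + (k + 1 : ℕ)) / ((k + 1 : ℕ) + 1)) := rfl
        have c2 : ∀ y, rf y (k + 1 + 1) = rf y (k + 1) * (y + (k + 1 : ℕ)) := fun _ => rfl
        rw [c1, c2, c2]
        have := (rf_pos hS (k + 1)).ne'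
        have h3 : S + ((k + 1 : ℕ) : ℝ) ≠ 0 := by positivity
        field_simp
      rw [e]
      have h2 : ((k + 1 : ℕ) : ℝ) ≤ ((k + 1 + 1 : ℕ) : ℝ) * ((β + (k + 1 : ℕ)) * (S - β + (k + 1 : ℕ)) / ((S + (k + 1 : ℕ)) * ((k + 1 : ℕ) + 1))) := by
        rw [mul_div_assoc', le_div_iff₀ (by positivity)]
        push_cast
        have : 0 < β * (S - β) := mul_pos hβ (by linarith)
        nlinarith [mul_nonneg (Nat.cast_nonneg (α := ℝ) k) this.le]
      calc ((k + 1 : ℕ) : ℝ) * t (k + 1) ≤ _ * t (k + 1) :=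
            mul_le_mul_of_nonneg_right h2 (htpos _)
        _ = _ := by ring
  have hlow2 : ∀ k : ℕ, t 1 * (1 / ((k : ℝ) + 1)) ≤ t (k + 1) := by
    intro k
    rw [mul_one_div, div_le_iff₀ (by positivity)]
    have := hlow k
    push_cast at this; linarith
  have ht1pos : 0 < t 1 := by rw [ht1]; exact div_pos (mul_pos hβ (by linarith)) hS
  have hlower : ∀ N, ENNReal.ofReal (∑ k ∈ Finset.range N, t k) ≤
      ∫⁻ x, ENNReal.ofReal (p x ^ (-α)) ∂ν := by
    intro N
    have e := beta_partial hp h0 h1 hS hm β 0 N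
    simp only [pow_zero, one_mul, rf, zero_add] at e
    simp only [ht]
    rw [← e, ofReal_integral_eq_lintegral_ofReal]
    · apply lintegral_mono_ae
      filter_upwards [hpos] with x hx
      apply ENNReal.ofReal_le_ofReal
      refine (partial_le β hβ.le hx (h1 x) N).trans ?_
      exact Real.rpow_le_rpow_of_exponent_ge hx (h1 x) (by linarith)
    · apply integrable_finsetSum
      intro k _
      have := (beta_int (ν := ν) hp h0 h1 0 k).const_mul (cf β k)
      simpa using this
    · refine ae_of_all _ fun x => Finset.sum_nonneg fun k _ => ?_
      exact mul_nonneg (cf_nonneg hβ.le k) (pow_nonneg (by linarith [h1 x]) _)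
  apply ENNReal.eq_top_of_forall_nnreal_le
  intro r
  obtain ⟨N, hN⟩ := (Real.tendsto_sum_range_one_div_nat_succ_atTop.eventually_ge_atTop ((r : ℝ) / t 1)).exists
  refine le_trans ?_ (hlower (N + 1))
  rw [← ENNReal.ofReal_coe_nnreal]
  apply ENNReal.ofReal_le_ofReal
  rw [Finset.sum_range_succ']
  have : t 1 * ∑ k ∈ Finset.range N, 1 / ((k : ℝ) + 1) ≤ ∑ k ∈ Finset.range N, t (k + 1) := by
    rw [Finset.mul_sum]; exact Finset.sum_le_sum fun k _ => hlow2 k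
  rw [div_le_iff₀ ht1pos] at hN
  linarith [htpos 0]

lemma beta_upper (hp : Measurable p) (h0 : ∀ x, 0 ≤ p x) (h1 : ∀ x, p x ≤ 1)
    (hS : 0 < S) (hβ : 0 < β) (hβS : β ≤ S)
    (hm : ∀ k : ℕ, ∫ x, p x ^ k ∂ν = rf β k / rf S k) {α : ℝ} (hα0 : 0 ≤ α) (hα1 : α ≤ 1)
    (hα : α ≤ β / 2) :
    ∫⁻ x, ENNReal.ofReal (p x ^ (-α)) ∂ν ≤ ENNReal.ofReal (2 * Real.exp (S / 2)) := by
  have hpos := beta_pos_ae hp h0 h1 hS hβ hβS hm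
  set t : ℕ → ℝ := fun k => cf α k * (rf (S - β) k / rf S k) with ht
  have htpos : ∀ k, 0 ≤ t k := fun k => mul_nonneg (cf_nonneg hα0 k)
    (div_nonneg (rf_nonneg (by linarith) k) (rf_pos hS k).le)
  -- telescoping
  have htel : ∀ N : ℕ, (β - α) * ∑ k ∈ Finset.range N, t k - (S - α) * ∑ k ∈ Finset.range N,
      cf α k * (rf β 1 * rf (S - β) k / rf S (1 + k)) = - (N * t N) := by
    intro N
    induction N with
    | zero => simp
    | succ N ih =>
      rw [Finset.sum_range_succ, Finset.sum_range_succ, mul_add, mul_add]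
      have : (β - α) * t N - (S - α) * (cf α N * (rf β 1 * rf (S - β) N / rf S (1 + N))) =
          N * t N - (N + 1 : ℕ) * t (N + 1) := by
        simp only [ht]
        rw [add_comm 1 N]
        simp only [rf, cf]
        have := (rf_pos hS N).ne'
        have h3 : S + (N : ℝ) ≠ 0 := by positivity
        push_cast
        field_simp
        ring
      linarith
  set m := β / S with hmdef
  have hmpos : 0 < m := by positivity
  have hEp : ∫ x, p x ∂ν = m := by
    have := hm 1
    simpa [rf] using this
  have hpint : Integrable p ν := by simpa using beta_int (ν := ν) hp h0 h1 1 0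
  have hE : ∀ N, ∑ k ∈ Finset.range N, cf α k * (rf β 1 * rf (S - β) k / rf S (1 + k)) ≤
      m ^ (1 - α) := by
    intro N
    rw [← beta_partial hp h0 h1 hS hm α 1 N]
    have hb : ∫ x, m ^ (1 - α) * ((1 - α) * (p x / m) + α) ∂ν = m ^ (1 - α) := by
      rw [integral_const_mul, integral_add, integral_const_mul, integral_div, hEp]
      · simp [div_self hmpos.ne']
      · exact (hpint.div_const m).const_mul _
      · exact integrable_const _
    rw [← hb]
    apply integral_mono_ae
    · simp only [Finset.mul_sum]
      apply integrable_finsetSum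
      intro k _
      have := (beta_int (ν := ν) hp h0 h1 1 k).const_mul (cf α k)
      refine this.congr (ae_of_all _ fun x => ?_)
      simp only; ring
    · exact ((((hpint.div_const m).const_mul _).add (integrable_const _)).const_mul _)
    · filter_upwards [hpos] with x hx
      calc p x ^ 1 * ∑ k ∈ Finset.range N, cf α k * (1 - p x) ^ k ≤ p x ^ 1 * p x ^ (-α) :=
            mul_le_mul_of_nonneg_left (partial_le α hα0 hx (h1 x) N) (by positivity)
        _ = p x ^ (1 - α) := by
            rw [pow_one, sub_eq_add_neg, Real.rpow_add hx, Real.rpow_one]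
        _ = m ^ (1 - α) * (p x / m) ^ (1 - α) := by
            rw [← Real.mul_rpow hmpos.le (by positivity)]; congr 1; field_simp
        _ ≤ _ := by
            apply mul_le_mul_of_nonneg_left _ (by positivity)
            have := Real.geom_mean_le_arith_mean2_weighted (w₁ := 1 - α) (w₂ := α)
              (p₁ := p x / m) (p₂ := 1) (by linarith) hα0 (by positivity) zero_le_one (by ring)
            simpa using this
  have hmα : m ^ (1 - α) ≤ m * Real.exp (S / 2) := by
    rw [sub_eq_add_neg, Real.rpow_add hmpos, Real.rpow_one]
    apply mul_le_mul_of_nonneg_left _ hmpos.le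
    rw [Real.rpow_def_of_pos hmpos]
    apply Real.exp_le_exp.mpr
    have hl : -Real.log m ≤ S / β := by
      rw [← Real.log_inv, hmdef, inv_div]
      exact (Real.log_le_sub_one_of_pos (by positivity)).trans (by linarith)
    calc Real.log m * -α = α * (-Real.log m) := by ring
      _ ≤ α * (S / β) := mul_le_mul_of_nonneg_left hl hα0
      _ ≤ (β / 2) * (S / β) := mul_le_mul_of_nonneg_right hα (by positivity)
      _ = S / 2 := by field_simp
  have hbound : ∀ N, ∑ k ∈ Finset.range N, t k ≤ 2 * Real.exp (S / 2) := by
    intro N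
    have e := htel N
    have hNt : 0 ≤ N * t N := mul_nonneg (Nat.cast_nonneg _) (htpos N)
    have hsum0 : 0 ≤ ∑ k ∈ Finset.range N, t k := Finset.sum_nonneg fun k _ => htpos k
    have a1 : (β - α) * ∑ k ∈ Finset.range N, t k ≤ (S - α) * (m * Real.exp (S / 2)) := by
      have := mul_le_mul_of_nonneg_left ((hE N).trans hmα) (by linarith : 0 ≤ S - α)
      linarith
    have a2 : (S - α) * (m * Real.exp (S / 2)) ≤ β * Real.exp (S / 2) := by
      have : S * (m * Real.exp (S / 2)) = β * Real.exp (S / 2) := by rw [hmdef]; field_simp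
      rw [← this]
      exact mul_le_mul_of_nonneg_right (by linarith) (by positivity)
    have a3 : (β / 2) * ∑ k ∈ Finset.range N, t k ≤ (β - α) * ∑ k ∈ Finset.range N, t k :=
      mul_le_mul_of_nonneg_right (by linarith) hsum0
    have a4 : β * (∑ k ∈ Finset.range N, t k) ≤ β * (2 * Real.exp (S / 2)) := by linarith
    exact le_of_mul_le_mul_left a4 hβ
  have hser : ∫⁻ x, ENNReal.ofReal (p x ^ (-α)) ∂ν = ∑' k, ENNReal.ofReal (t k) := by
    have : ∫⁻ x, ENNReal.ofReal (p x ^ (-α)) ∂ν =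
        ∫⁻ x, ∑' k, ENNReal.ofReal (cf α k * (1 - p x) ^ k) ∂ν := by
      apply lintegral_congr_ae
      filter_upwards [hpos] with x hx
      have h := hasSum_cf α (x := 1 - p x) (by linarith [h1 x]) (by linarith)
      rw [sub_sub_cancel] at h
      rw [← h.tsum_eq]
      exact ENNReal.ofReal_tsum_of_nonneg (fun k => mul_nonneg (cf_nonneg hα0 k)
        (pow_nonneg (by linarith [h1 x]) _)) h.summable
    rw [this, lintegral_tsum]
    · congr 1; ext k
      rw [← ofReal_integral_eq_lintegral_ofReal]
      · rw [integral_const_mul]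
        have := beta_mom hp h0 h1 hS hm k 0
        simp only [pow_zero, one_mul, rf, zero_add] at this
        rw [this]
      · simpa using (beta_int (ν := ν) hp h0 h1 0 k).const_mul (cf α k)
      · refine ae_of_all _ fun x => ?_
        exact mul_nonneg (cf_nonneg hα0 k) (pow_nonneg (by linarith [h1 x]) _)
    · intro k
      exact (((measurable_const.sub hp).pow_const k).const_mul _).ennreal_ofReal.aemeasurable
  rw [hser]
  apply ENNReal.tsum_le_of_sum_range_le
  intro N
  rw [← ENNReal.ofReal_sum_of_nonneg fun k _ => htpos k]
  exact ENNReal.ofReal_le_ofReal (hbound N)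

end beta

lemma gamma_rf {x : ℝ} (hx : 0 < x) (k : ℕ) : Real.Gamma (x + k) = rf x k * Real.Gamma x := by
  induction k with
  | zero => simp [rf]
  | succ k ih =>
    have : x + ((k + 1 : ℕ) : ℝ) = (x + k) + 1 := by push_cast; ring
    rw [this, Real.Gamma_add_one (by positivity), ih]
    simp only [rf]; ring

/-- The Dirichlet moments in terms of rising factorials. -/
lemma dir_mom {d : ℕ} {μ : Measure (Simplex d)} {β : Fin (2 * d) → ℝ} (hβ : ∀ i, 0 < β i)
    (hS : 0 < ∑ i, β i) (h : IsDirichlet d μ β) (k : Fin (2 * d) → ℕ) :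
    ∫ p, ∏ i, (p.1 i) ^ (k i) ∂μ = (∏ i, rf (β i) (k i)) / rf (∑ i, β i) (∑ i, k i) := by
  rw [h.2 k]
  have e : ((∑ i, β i) + ∑ i, (k i : ℝ)) = (∑ i, β i) + ((∑ i, k i : ℕ) : ℝ) := by push_cast; rfl
  rw [e, gamma_rf hS]
  have hG := (Real.Gamma_pos_of_pos hS).ne'
  have hr := (rf_pos hS (∑ i, k i)).ne'
  have : ∀ i, Real.Gamma (β i + k i) / Real.Gamma (β i) = rf (β i) (k i) := by
    intro i
    rw [gamma_rf (hβ i)]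
    exact mul_div_cancel_right₀ _ (Real.Gamma_pos_of_pos (hβ i)).ne'
  simp only [this]
  field_simp

lemma dir_mom1 {d : ℕ} {μ : Measure (Simplex d)} {β : Fin (2 * d) → ℝ} (hβ : ∀ i, 0 < β i)
    (hS : 0 < ∑ i, β i) (h : IsDirichlet d μ β) (i : Fin (2 * d)) (k : ℕ) :
    ∫ p, (p.1 i) ^ k ∂μ = rf (β i) k / rf (∑ i, β i) k := by
  have := dir_mom hβ hS h (Pi.single i k)
  rw [Finset.sum_pi_single'] at this
  simp only [Finset.mem_univ, if_true] at this
  rw [← Finset.prod_erase_mul Finset.univ _ (Finset.mem_univ i)] at this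
  rw [Finset.prod_eq_one, one_mul, Pi.single_eq_same] at this
  · rw [← this]
    congr 1; ext p
    rw [← Finset.prod_erase_mul Finset.univ _ (Finset.mem_univ i), Finset.prod_eq_one, one_mul,
      Pi.single_eq_same]
    intro j hj
    rw [Pi.single_eq_of_ne (Finset.ne_of_mem_erase hj), pow_zero]
  · intro j hj
    rw [Pi.single_eq_of_ne (Finset.ne_of_mem_erase hj)]; rfl

lemma simplex_le_one {d : ℕ} (p : Simplex d) (i : Fin (2 * d)) : p.1 i ≤ 1 := by
  exact (Finset.single_le_sum (fun j _ => p.2.1 j) (Finset.mem_univ i)).trans_eq p.2.2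

lemma simplex_meas {d : ℕ} (i : Fin (2 * d)) : Measurable (fun p : Simplex d => p.1 i) :=
  (measurable_pi_apply i).comp measurable_subtype_coe

lemma iid_map {d : ℕ} {ℙ : Measure (Env d)} {μ : Measure (Simplex d)} (h : IsIIDWith d ℙ μ)
    (x : V d) : ℙ.map (fun ω => ω x) = μ := by
  ext A hA
  rw [Measure.map_apply (measurable_pi_apply x) hA]
  have := h.2.2 {x} (fun _ => A) (fun _ => hA)
  simp only [Finset.mem_singleton, forall_eq, Finset.prod_singleton] at this
  exact this

lemma eta_eq {d : ℕ} {ℙ : Measure (Env d)} {μ : Measure (Simplex d)} (h : IsIIDWith d ℙ μ)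
    (α : ℝ) : eta d ℙ α = ⨆ i : Fin (2 * d), ∫⁻ p, ENNReal.ofReal (p.1 i ^ (-α)) ∂μ := by
  unfold eta
  congr 1; ext i
  rw [← iid_map h 0, lintegral_map _ (measurable_pi_apply _)]
  exact ((simplex_meas i).pow_const _).ennreal_ofReal

lemma c0_bound {d : ℕ} {ℙ : Measure (Env d)} {μ : Measure (Simplex d)} {β : Fin (2 * d) → ℝ}
    (hβ : ∀ i, 0 < β i) (i0 i1 : Fin (2 * d)) (h01 : i1 ≠ i0) (hi0 : ∀ i, β i0 ≤ β i)
    (hb1 : β i0 ≤ 1)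
    (S1 : ℝ) (hS1 : ∑ i, β i ≤ S1) (h : IsIIDWith d ℙ μ) (hD : IsDirichlet d μ β) :
    c0 d ℙ ≤ (2 / 3) * (3 : ℝ) ^ (120 * (d : ℝ) ^ 4 +
      3000 * (d : ℝ) * (Real.log (2 * Real.exp (S1 / 2))) ^ 2) := by
  have hS : 0 < ∑ i, β i := Finset.sum_pos (fun i _ => hβ i) ⟨i0, Finset.mem_univ _⟩
  have hlt : β i0 < ∑ i, β i := by
    have := Finset.add_le_sum (fun i _ => (hβ i).le) (Finset.mem_univ i0) (Finset.mem_univ i1) h01.symm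
    linarith [hβ i1]
  have hle : ∀ i, β i ≤ ∑ i, β i := fun i =>
    Finset.single_le_sum (fun j _ => (hβ j).le) (Finset.mem_univ i)
  have := hD.1
  set S := ∑ i, β i with hSdef
  have habar : 0 ≤ alphaBar d ℙ ∧ alphaBar d ℙ ≤ β i0 := by
    constructor
    · exact Real.sSup_nonneg fun x hx => hx.1
    · refine Real.sSup_le ?_ (hβ i0).le
      intro α hα
      by_contra hcon
      push Not at hcon
      have h2 := hα.2
      rw [eta_eq h] at h2
      have h3 := beta_diverge (ν := μ) (simplex_meas i0) (fun p => p.2.1 i0)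
        (fun p => simplex_le_one p i0) hS (hβ i0) hlt (dir_mom1 hβ hS hD i0) hcon.le
      have h4 := le_iSup (fun i : Fin (2 * d) => ∫⁻ p, ENNReal.ofReal (p.1 i ^ (-α)) ∂μ) i0
      simp only [h3] at h4
      exact absurd (lt_of_le_of_lt h4 h2) (lt_irrefl _)
  have hup : eta d ℙ (alphaBar d ℙ / 2) ≤ ENNReal.ofReal (2 * Real.exp (S1 / 2)) := by
    rw [eta_eq h]
    refine iSup_le fun i => ?_
    refine (beta_upper (ν := μ) (simplex_meas i) (fun p => p.2.1 i)
        (fun p => simplex_le_one p i) hS (hβ i) (hle i) (dir_mom1 hβ hS hD i) (by linarith)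
        (by linarith) (by linarith [hi0 i])).trans ?_
    apply ENNReal.ofReal_le_ofReal
    have : Real.exp (S / 2) ≤ Real.exp (S1 / 2) := Real.exp_le_exp.mpr (by linarith)
    linarith
  have hlow : 1 ≤ eta d ℙ (alphaBar d ℙ / 2) := by
    rw [eta_eq h]
    refine le_trans ?_ (le_iSup _ i0)
    have hpos := beta_pos_ae (ν := μ) (simplex_meas i0) (fun p => p.2.1 i0)
        (fun p => simplex_le_one p i0) hS (hβ i0) (hle i0) (dir_mom1 hβ hS hD i0)
    calc (1 : ℝ≥0∞) = ∫⁻ _p, 1 ∂μ := by simp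
      _ ≤ _ := by
        apply lintegral_mono_ae
        filter_upwards [hpos] with p hp
        rw [ENNReal.one_le_ofReal]
        exact Real.one_le_rpow_of_pos_of_le_one_of_nonpos hp (simplex_le_one p i0) (by linarith)
  set y := (eta d ℙ (alphaBar d ℙ / 2)).toReal with hy
  have hy1 : 1 ≤ y := by
    rw [hy, ← ENNReal.toReal_one]
    exact ENNReal.toReal_mono (ne_top_of_le_ne_top ENNReal.ofReal_ne_top hup) hlow
  have hy2 : y ≤ 2 * Real.exp (S1 / 2) := by
    have := ENNReal.toReal_mono ENNReal.ofReal_ne_top hup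
    rwa [ENNReal.toReal_ofReal (by positivity)] at this
  unfold c0
  rw [← hy]
  apply mul_le_mul_of_nonneg_left _ (by norm_num)
  apply Real.rpow_le_rpow_of_exponent_le (by norm_num)
  have hl0 := Real.log_nonneg hy1
  have hl1 := Real.log_le_log (by linarith) hy2
  gcongr

/-- Endpoint of the path with the given (reversed) list of steps. -/
def pos {d : ℕ} : List (Fin (2 * d)) → V d
  | [] => 0
  | (i :: s) => pos s + dir d i

/-- Departed sites. -/
def vis {d : ℕ} : List (Fin (2 * d)) → List (V d)
  | [] => []
  | (_ :: s) => pos s :: vis s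

/-- Crossed edges. -/
def edg {d : ℕ} : List (Fin (2 * d)) → List (V d × Fin (2 * d))
  | [] => []
  | (i :: s) => (pos s, i) :: edg s

/-- Transition probability of the reinforced walk. -/
noncomputable def pr {d : ℕ} (β : Fin (2 * d) → ℝ) (s : List (Fin (2 * d))) (i : Fin (2 * d)) : ℝ :=
  (β i + (edg s).count (pos s, i)) / ((∑ j, β j) + (vis s).count (pos s))

/-- Annealed weight of a path. -/
noncomputable def W {d : ℕ} (β : Fin (2 * d) → ℝ) : List (Fin (2 * d)) → ℝ
  | [] => 1
  | (i :: s) => W β s * pr β s i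

/-- All step lists of length `n`. -/
noncomputable def paths (d : ℕ) : ℕ → Finset (List (Fin (2 * d)))
  | 0 => {[]}
  | (n + 1) => (paths d n ×ˢ (Finset.univ : Finset (Fin (2 * d)))).image fun q => q.2 :: q.1

lemma sum_paths_succ {d n : ℕ} (F : List (Fin (2 * d)) → ℝ) :
    ∑ s ∈ paths d (n + 1), F s = ∑ s ∈ paths d n, ∑ i, F (i :: s) := by
  rw [paths, Finset.sum_image, Finset.sum_product]
  rintro ⟨a, b⟩ _ ⟨a', b'⟩ _ h
  simp only [List.cons.injEq] at h
  rw [h.1, h.2]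

lemma mem_paths {d n : ℕ} {s : List (Fin (2 * d))} : s ∈ paths d n ↔ s.length = n := by
  induction n generalizing s with
  | zero => simp [paths]
  | succ n ih =>
    simp only [paths, Finset.mem_image, Finset.mem_product, ih, Finset.mem_univ, and_true]
    constructor
    · rintro ⟨⟨a, b⟩, h, rfl⟩; simp at h ⊢; exact h
    · intro h
      cases s with
      | nil => simp at h
      | cons i s => exact ⟨(s, i), by simpa using h, rfl⟩

lemma count_edg {d : ℕ} (s : List (Fin (2 * d))) (x : V d) :
    ∑ i, (edg s).count (x, i) = (vis s).count x := by
  induction s with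
  | nil => simp [edg, vis]
  | cons i s ih =>
    simp only [edg, vis, List.count_cons, Finset.sum_add_distrib, ih]
    congr 1
    by_cases h : pos s = x
    · simp [h]
    · simp [h]

lemma vis_length {d : ℕ} (s : List (Fin (2 * d))) : (vis s).length = s.length := by
  induction s with
  | nil => rfl
  | cons i s ih => simp [vis, ih]


lemma pr_nonneg {d : ℕ} {β : Fin (2 * d) → ℝ} (hβ : ∀ i, 0 < β i) 
    (s : List (Fin (2 * d))) (i : Fin (2 * d)) : 0 ≤ pr β s i := by
  unfold pr
  have : 0 ≤ ∑ j, β j := Finset.sum_nonneg fun j _ => (hβ j).le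
  have := hβ i
  positivity

lemma pr_sum {d : ℕ} {β : Fin (2 * d) → ℝ} (hβ : ∀ i, 0 < β i) (iu : Fin (2 * d)) 
    (s : List (Fin (2 * d))) : ∑ i, pr β s i = 1 := by
  have : 0 < ∑ j, β j := Finset.sum_pos (fun j _ => hβ j) ⟨iu, Finset.mem_univ _⟩
  unfold pr
  rw [← Finset.sum_div, Finset.sum_add_distrib, ← count_edg s (pos s)]
  push_cast
  apply div_self
  positivity

lemma W_nonneg {d : ℕ} {β : Fin (2 * d) → ℝ} (hβ : ∀ i, 0 < β i) 
    (s : List (Fin (2 * d))) : 0 ≤ W β s := by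
  induction s with
  | nil => simp [W]
  | cons i s ih => exact mul_nonneg ih (pr_nonneg hβ s i)

lemma W_sum {d : ℕ} {β : Fin (2 * d) → ℝ} (hβ : ∀ i, 0 < β i) (iu : Fin (2 * d)) 
    (n : ℕ) : ∑ s ∈ paths d n, W β s = 1 := by
  induction n with
  | zero => simp [paths, W]
  | succ n ih =>
    rw [sum_paths_succ, ← ih]
    apply Finset.sum_congr rfl
    intro s _
    simp only [W]
    rw [← Finset.mul_sum, pr_sum hβ iu, mul_one]

lemma edg_not_mem {d : ℕ} {s : List (Fin (2 * d))} {i : Fin (2 * d)} (h : i ∉ s) (x : V d) :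
    (x, i) ∉ edg s := by
  induction s with
  | nil => simp [edg]
  | cons j s ih =>
    simp only [List.mem_cons, not_or] at h
    simp only [edg, List.mem_cons, Prod.mk.injEq, not_or]
    exact ⟨fun hh => h.1 hh.2, ih h.2⟩

/-- The probability of a downward step in the first `n` steps is small. -/
lemma down_bound {d : ℕ} {β : Fin (2 * d) → ℝ} (hβ : ∀ i, 0 < β i) (iu idn : Fin (2 * d)) 
    (n : ℕ) :
    ∑ s ∈ (paths d n).filter (fun s => idn ∈ s), W β s ≤ n * (β idn / β iu) := by
  rw [Finset.sum_filter]
  induction n with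
  | zero => simp [paths]
  | succ n ih =>
    rw [sum_paths_succ]
    have hstep : ∀ s ∈ paths d n, ∑ i, (if idn ∈ i :: s then W β (i :: s) else 0) ≤
        (if idn ∈ s then W β s else 0) + W β s * (β idn / β iu) := by
      intro s _
      by_cases h : idn ∈ s
      · simp only [List.mem_cons, h, or_true, if_true, W]
        rw [← Finset.mul_sum, pr_sum hβ iu, mul_one]
        have := W_nonneg hβ s
        have := hβ idn
        have := hβ iu
        have : 0 ≤ W β s * (β idn / β iu) := by positivity
        linarith
      · simp only [List.mem_cons, h, or_false, if_false, zero_add, W]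
        rw [Finset.sum_ite_eq]
        simp only [Finset.mem_univ, if_true]
        apply mul_le_mul_of_nonneg_left _ (W_nonneg hβ s)
        unfold pr
        rw [List.count_eq_zero_of_not_mem (edg_not_mem h _)]
        simp only [Nat.cast_zero, add_zero]
        apply div_le_div_of_nonneg_left (hβ idn).le (hβ iu)
        have : β iu ≤ ∑ j, β j := Finset.single_le_sum (fun j _ => (hβ j).le) (Finset.mem_univ iu)
        have h3 : (0 : ℝ) ≤ ((vis s).count (pos s) : ℝ) := Nat.cast_nonneg _
        linarith
    refine (Finset.sum_le_sum hstep).trans ?_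
    rw [Finset.sum_add_distrib, ← Finset.sum_mul, W_sum hβ iu, one_mul]
    push_cast
    linarith


/-- The growth factor. -/
noncomputable def gr (B S1 : ℝ) (m : ℕ) : ℝ := 1 / (1 - B / (2 * (S1 + m)))


lemma gr_den {B S1 : ℝ} (hB : 0 < B) (hBS : B ≤ S1) 
    (m : ℕ) : 0 < 1 - B / (2 * (S1 + m)) ∧ 1 - B / (2 * (S1 + m)) < 1 := by
  have hS : 0 < S1 := lt_of_lt_of_le hB hBS
  have h1 : B / (2 * (S1 + m)) < 1 := by
    rw [div_lt_one (by positivity)]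
    have : (0 : ℝ) ≤ m := Nat.cast_nonneg m
    linarith
  have h2 : 0 < B / (2 * (S1 + m)) := by positivity
  constructor <;> linarith

lemma one_lt_gr {B S1 : ℝ} (hB : 0 < B) (hBS : B ≤ S1) 
    (m : ℕ) : 1 < gr B S1 m := by
  have := gr_den hB hBS m
  unfold gr
  rw [one_lt_div this.1]
  exact this.2

lemma gr_prod {B S1 : ℝ} (hB : 0 < B) (hBS : B ≤ S1) 
    (C : ℝ) : ∃ m : ℕ, C ≤ ∏ j ∈ Finset.range m, gr B S1 j := by
  have hS : 0 < S1 := lt_of_lt_of_le hB hBS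
  obtain ⟨m, hm⟩ := harm hS (C * (2 / B))
  refine ⟨m, ?_⟩
  have h1 : ∀ j : ℕ, 1 + B / 2 * (1 / (S1 + j)) ≤ gr B S1 j := by
    intro j
    have h := gr_den hB hBS j
    unfold gr
    rw [le_div_iff₀ h.1]
    have e : B / 2 * (1 / (S1 + j)) = B / (2 * (S1 + j)) := by
      have : S1 + (j : ℝ) ≠ 0 := by positivity
      field_simp
    rw [e]
    nlinarith [sq_nonneg (B / (2 * (S1 + (j : ℝ))))]
  have h2 : ∀ m : ℕ, 1 + B / 2 * ∑ j ∈ Finset.range m, (1 / (S1 + j)) ≤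
      ∏ j ∈ Finset.range m, gr B S1 j := by
    intro m
    induction m with
    | zero => simp
    | succ m ih =>
      rw [Finset.sum_range_succ, Finset.prod_range_succ]
      have hs : 0 ≤ ∑ j ∈ Finset.range m, (1 / (S1 + (j : ℝ))) :=
        Finset.sum_nonneg fun j _ => by positivity
      have ht : 0 ≤ B / 2 * (1 / (S1 + (m : ℝ))) := by positivity
      have hs' : 0 ≤ B / 2 * ∑ j ∈ Finset.range m, (1 / (S1 + (j : ℝ))) := by positivity
      calc _ ≤ (1 + B / 2 * ∑ j ∈ Finset.range m, (1 / (S1 + j))) * (1 + B / 2 * (1 / (S1 + m))) := by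
            nlinarith [mul_nonneg hs' ht]
        _ ≤ _ := mul_le_mul ih (h1 m) (by linarith) (by linarith)
  have h3 := h2 m
  have h4 : C ≤ B / 2 * ∑ j ∈ Finset.range m, (1 / (S1 + (j : ℝ))) := by
    calc C = B / 2 * (C * (2 / B)) := by field_simp
      _ ≤ _ := mul_le_mul_of_nonneg_left hm (by positivity)
  linarith


/-- Growth part of the supermartingale. -/
noncomputable def Q {d : ℕ} (B S1 : ℝ) : List (Fin (2 * d)) → ℝ
  | [] => 1
  | (_ :: s) => Q B S1 s * gr B S1 ((vis s).count (pos s))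

/-- The supermartingale. -/
noncomputable def Z {d : ℕ} (B S1 : ℝ) (iu : Fin (2 * d)) (s : List (Fin (2 * d))) : ℝ :=
  Q B S1 s * (1 / 2) ^ (s.count iu)

/-- The stopped supermartingale. -/
noncomputable def Y {d : ℕ} (B S1 : ℝ) (iu : Fin (2 * d)) (Λ : ℝ) : List (Fin (2 * d)) → ℝ
  | [] => 1
  | (i :: s) => if Λ ≤ Y B S1 iu Λ s then Y B S1 iu Λ s else Z B S1 iu (i :: s)


lemma Q_one {d : ℕ} {B S1 : ℝ} (hB : 0 < B) (hBS : B ≤ S1) 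
    (s : List (Fin (2 * d))) : 1 ≤ Q B S1 s := by
  induction s with
  | nil => simp [Q]
  | cons i s ih =>
    exact one_le_mul_of_one_le_of_one_le ih (one_lt_gr hB hBS _).le

lemma Z_nonneg {d : ℕ} {B S1 : ℝ} (hB : 0 < B) (hBS : B ≤ S1) 
    (iu : Fin (2 * d)) (s : List (Fin (2 * d))) : 0 ≤ Z B S1 iu s := by
  have := Q_one hB hBS s
  unfold Z; positivity

lemma Y_nonneg {d : ℕ} {B S1 : ℝ} (hB : 0 < B) (hBS : B ≤ S1) 
    (iu : Fin (2 * d)) (Λ : ℝ) (s : List (Fin (2 * d))) : 0 ≤ Y B S1 iu Λ s := by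
  induction s with
  | nil => simp [Y]
  | cons i s ih =>
    simp only [Y]
    split_ifs
    · exact ih
    · exact Z_nonneg hB hBS _ _

lemma Q_distinct {d : ℕ} {B S1 : ℝ} (hB : 0 < B) (hBS : B ≤ S1) 
    (s : List (Fin (2 * d))) : gr B S1 0 ^ (vis s).toFinset.card ≤ Q B S1 s := by
  induction s with
  | nil => simp [Q, vis]
  | cons i s ih =>
    have hg := one_lt_gr hB hBS
    simp only [Q, vis, List.toFinset_cons]
    by_cases h : pos s ∈ (vis s).toFinset
    · rw [Finset.insert_eq_of_mem h]
      have := Q_one hB hBS s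
      exact ih.trans (le_mul_of_one_le_right (by linarith) (hg _).le)
    · rw [Finset.card_insert_of_notMem h, pow_succ]
      rw [List.count_eq_zero_of_not_mem (by simpa using h)]
      exact mul_le_mul_of_nonneg_right ih (by linarith [hg 0])

lemma Q_site {d : ℕ} {B S1 : ℝ} (hB : 0 < B) (hBS : B ≤ S1) 
    (s : List (Fin (2 * d))) (x : V d) :
    ∏ j ∈ Finset.range ((vis s).count x), gr B S1 j ≤ Q B S1 s := by
  induction s with
  | nil => simp [Q, vis]
  | cons i s ih =>
    have hg := one_lt_gr hB hBS
    simp only [Q, vis]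
    by_cases h : pos s = x
    · subst h
      rw [List.count_cons_self, Finset.prod_range_succ]
      exact mul_le_mul_of_nonneg_right ih (by linarith [hg ((vis s).count (pos s))])
    · rw [List.count_cons_of_ne h]
      have := Q_one hB hBS s
      exact ih.trans (le_mul_of_one_le_right (by linarith) (hg _).le)


lemma Z_super {d : ℕ} {B S1 : ℝ} (hB : 0 < B) (hBS : B ≤ S1) {β : Fin (2 * d) → ℝ} (hβ : ∀ i, 0 < β i) {iu : Fin (2 * d)}
    (hu : β iu = B) (hS1 : ∑ i, β i ≤ S1) 
    (s : List (Fin (2 * d))) : ∑ i, pr β s i * Z B S1 iu (i :: s) ≤ Z B S1 iu s := by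
  have hg := gr_den hB hBS ((vis s).count (pos s))
  have hQ := Q_one hB hBS s
  have hSpos : 0 < ∑ j, β j := Finset.sum_pos (fun j _ => hβ j) ⟨iu, Finset.mem_univ _⟩
  have e : ∀ i, pr β s i * Z B S1 iu (i :: s) = (Z B S1 iu s * gr B S1 ((vis s).count (pos s))) *
      (pr β s i - if i = iu then pr β s i / 2 else 0) := by
    intro i
    unfold Z
    simp only [Q]
    by_cases h : i = iu
    · subst h
      rw [List.count_cons_self, pow_succ]; simp; ring
    · rw [List.count_cons_of_ne h]; simp [h]; ring
  simp only [e]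
  rw [← Finset.mul_sum, Finset.sum_sub_distrib, pr_sum hβ iu, Finset.sum_ite_eq']
  simp only [Finset.mem_univ, if_true]
  have hlow : B / (2 * (S1 + (vis s).count (pos s))) ≤ pr β s iu / 2 := by
    unfold pr
    rw [hu, div_div, mul_comm (2 : ℝ)]
    have : (0 : ℝ) ≤ (edg s).count (pos s, iu) := Nat.cast_nonneg _
    have h2 : (0 : ℝ) ≤ (vis s).count (pos s) := Nat.cast_nonneg _
    apply div_le_div₀ <;> first | linarith | nlinarith
  rw [mul_assoc]
  apply mul_le_of_le_one_right (Z_nonneg hB hBS _ _)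
  unfold gr
  rw [one_div, inv_mul_le_one₀ hg.1]
  linarith

lemma Y_super {d : ℕ} {B S1 : ℝ} (hB : 0 < B) (hBS : B ≤ S1) {β : Fin (2 * d) → ℝ} (hβ : ∀ i, 0 < β i) {iu : Fin (2 * d)}
    (hu : β iu = B) (hS1 : ∑ i, β i ≤ S1) 
    (Λ : ℝ) (n : ℕ) : ∑ s ∈ paths d n, W β s * Y B S1 iu Λ s ≤ 1 := by
  have hinv : ∀ s : List (Fin (2 * d)), Λ ≤ Y B S1 iu Λ s ∨ Y B S1 iu Λ s = Z B S1 iu s := by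
    intro s
    cases s with
    | nil => right; simp [Y, Z, Q]
    | cons i s =>
      by_cases h : Λ ≤ Y B S1 iu Λ s
      · left; simp [Y, h]
      · right; simp [Y, h]
  induction n with
  | zero => simp [paths, W, Y]
  | succ n ih =>
    rw [sum_paths_succ]
    refine le_trans (Finset.sum_le_sum fun s _ => ?_) ih
    simp only [W, mul_assoc]
    rw [← Finset.mul_sum]
    apply mul_le_mul_of_nonneg_left _ (W_nonneg hβ s)
    by_cases h : Λ ≤ Y B S1 iu Λ s
    · simp only [Y, h, if_true]
      rw [← Finset.sum_mul, pr_sum hβ iu, one_mul]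
    · simp only [Y, h, if_false]
      rw [(hinv s).resolve_left h]
      exact Z_super hB hBS hβ hu hS1 s

/-- Maximal inequality. -/
lemma ville {d : ℕ} {B S1 : ℝ} (hB : 0 < B) (hBS : B ≤ S1) {β : Fin (2 * d) → ℝ} (hβ : ∀ i, 0 < β i) {iu : Fin (2 * d)}
    (hu : β iu = B) (hS1 : ∑ i, β i ≤ S1) 
    {Λ : ℝ} (hΛ : 1 ≤ Λ) (n : ℕ) (G : List (Fin (2 * d)) → Prop)
    (hG : ∀ s ∈ paths d n, G s → ∃ t, t <:+ s ∧ Λ ≤ Z B S1 iu t) :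
    ∑ s ∈ (paths d n).filter G, W β s ≤ 1 / Λ := by
  have hcross : ∀ s t : List (Fin (2 * d)), t <:+ s → Λ ≤ Z B S1 iu t → Λ ≤ Y B S1 iu Λ s := by
    intro s
    induction s with
    | nil =>
      intro t ht h
      rw [List.suffix_nil] at ht
      subst ht
      simpa [Y, Z, Q] using h
    | cons i s ih =>
      intro t ht h
      simp only [Y]
      split_ifs with h1
      · exact h1
      · rcases List.suffix_cons_iff.mp ht with h2 | h2
        · rw [← h2]; exact h
        · exact absurd (ih t h2 h) h1
  have h0 : 0 < Λ := by linarith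
  rw [le_div_iff₀ h0, Finset.sum_mul]
  refine le_trans ?_ (Y_super hB hBS hβ hu hS1 Λ n)
  calc ∑ s ∈ (paths d n).filter G, W β s * Λ ≤ ∑ s ∈ (paths d n).filter G, W β s * Y B S1 iu Λ s := by
        apply Finset.sum_le_sum
        intro s hs
        rw [Finset.mem_filter] at hs
        obtain ⟨t, ht, h⟩ := hG s hs.1 hs.2
        exact mul_le_mul_of_nonneg_left (hcross s t ht h) (W_nonneg hβ s)
    _ ≤ _ := by
        apply Finset.sum_le_sum_of_subset_of_nonneg (Finset.filter_subset _ _)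
        intro s _ _
        exact mul_nonneg (W_nonneg hβ s) (Y_nonneg hB hBS _ _ _)


lemma idx_lt {d : ℕ} (hd : 1 ≤ d) : d < 2 * d := by omega

lemma dir_abs {d : ℕ} (i : Fin (2 * d)) (j : Fin d) : |dir d i j| ≤ 1 := by
  unfold dir
  split_ifs <;> simp

lemma dir_up {d : ℕ} (hd : 1 ≤ d) : dir d ⟨0, by omega⟩ ⟨0, by omega⟩ = 1 := by
  simp only [dir]
  rw [if_pos (Or.inl trivial), if_pos (show (0 : ℕ) < d by omega)]

lemma dir_other {d : ℕ} (hd : 1 ≤ d) (i : Fin (2 * d)) (h0 : i ≠ ⟨0, by omega⟩)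
    (h1 : i ≠ ⟨d, idx_lt hd⟩) : dir d i ⟨0, by omega⟩ = 0 := by
  simp only [dir]
  rw [if_neg]
  simp only [ne_eq, Fin.ext_iff] at h0 h1
  omega

lemma dir_inj {d : ℕ} : Function.Injective (dir d) := by
  intro i i' h
  have hi := i.isLt
  have hi' := i'.isLt
  rw [Fin.ext_iff]
  by_cases hlt : (i : ℕ) < d
  · have h1 := congrFun h ⟨i, hlt⟩
    simp only [dir, true_or, if_true, hlt] at h1
    split_ifs at h1 with h2 h3 <;> omega
  · have hlt2 : (i : ℕ) - d < d := by omega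
    have h1 := congrFun h ⟨i - d, hlt2⟩
    simp only [dir, hlt, if_false] at h1
    rw [if_pos (Or.inr (by omega))] at h1
    split_ifs at h1 with h2 h3 <;> omega

lemma pos_height {d : ℕ} (hd : 1 ≤ d) (s : List (Fin (2 * d))) (h : (⟨d, idx_lt hd⟩ : Fin (2 * d)) ∉ s) :
    pos s ⟨0, by omega⟩ = s.count ⟨0, by omega⟩ := by
  induction s with
  | nil => simp [pos]
  | cons i s ih =>
    simp only [List.mem_cons, not_or] at h
    simp only [pos, Pi.add_apply]
    rw [ih h.2]
    by_cases h0 : i = ⟨0, by omega⟩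
    · subst h0
      rw [List.count_cons_self, dir_up hd]; push_cast; rfl
    · rw [List.count_cons_of_ne h0, dir_other hd i h0 (fun hh => h.1 hh.symm), add_zero]

lemma pos_lateral {d : ℕ} (s : List (Fin (2 * d))) (j : Fin d) :
    (∀ y ∈ vis s, |y j| + 1 ≤ ((vis s).toFinset.card : ℤ)) ∧
      |pos s j| ≤ ((vis s).toFinset.card : ℤ) := by
  induction s with
  | nil => simp [vis, pos]
  | cons i s ih =>
    have hkey : ∀ y ∈ vis (i :: s), |y j| + 1 ≤ ((vis (i :: s)).toFinset.card : ℤ) := by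
      intro y hy
      simp only [vis, List.toFinset_cons]
      by_cases h : pos s ∈ (vis s).toFinset
      · rw [Finset.insert_eq_of_mem h]
        apply ih.1
        simp only [vis, List.mem_cons] at hy
        rcases hy with rfl | hy
        · simpa using h
        · exact hy
      · rw [Finset.card_insert_of_notMem h]
        simp only [vis, List.mem_cons] at hy
        push_cast
        rcases hy with rfl | hy
        · linarith [ih.2]
        · linarith [ih.1 y hy]
    refine ⟨hkey, ?_⟩
    have h1 := hkey (pos s) (by simp [vis])
    refine le_trans ?_ h1
    simp only [pos, Pi.add_apply]
    exact (abs_add_le _ _).trans (by linarith [dir_abs i j])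

/-- The path leaves the set through the front. -/
def Good {d : ℕ} (hd : 1 ≤ d) (ℓ : ℕ) (I : Set (V d)) (s : List (Fin (2 * d))) : Prop :=
  ∃ t, t <:+ s ∧ (ℓ : ℤ) ≤ pos t ⟨0, by omega⟩ ∧ pos t ∉ I ∧
    ∀ u, u <:+ t → u ≠ t → pos u ∈ I

lemma first_suffix {α : Type*} (P : List α → Prop) (s : List α) (h : ∃ u, u <:+ s ∧ ¬ P u) :
    ∃ t, t <:+ s ∧ ¬ P t ∧ ∀ u, u <:+ t → u ≠ t → P u := by
  induction s with
  | nil =>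
    obtain ⟨u, hu, hP⟩ := h
    rw [List.suffix_nil] at hu
    subst hu
    refine ⟨[], List.suffix_rfl, hP, fun u hu hne => ?_⟩
    rw [List.suffix_nil] at hu
    exact absurd hu hne
  | cons a s ih =>
    by_cases hs : ∃ u, u <:+ s ∧ ¬ P u
    · obtain ⟨t, ht, h1, h2⟩ := ih hs
      exact ⟨t, ht.trans (List.suffix_cons a s), h1, h2⟩
    · push Not at hs
      obtain ⟨u, hu, hP⟩ := h
      rcases List.suffix_cons_iff.mp hu with h2 | h2
      · subst h2
        refine ⟨_, List.suffix_rfl, hP, fun u hu hne => ?_⟩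
        rcases List.suffix_cons_iff.mp hu with h3 | h3
        · exact absurd h3 hne
        · exact hs u h3
      · exact absurd (hs u h2) hP

lemma bad_cross {d : ℕ} (hd : 1 ≤ d) {B S1 : ℝ} (hB : 0 < B) (hBS : B ≤ S1) (ℓ K m : ℕ)
    (hℓ : 1 ≤ ℓ)
    (hm : gr B S1 0 ^ K ≤ ∏ j ∈ Finset.range m, gr B S1 j) (I : Set (V d))
    (hI : ∀ x ∈ I, x ⟨0, by omega⟩ < (ℓ : ℤ))
    (hI2 : ∀ x, x ∉ I → (ℓ : ℤ) ≤ x ⟨0, by omega⟩ ∨ x ⟨0, by omega⟩ ≤ -(ℓ : ℤ) ∨ ∃ j, (K : ℤ) ≤ |x j|)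
    (s : List (Fin (2 * d))) (hs : s.length = K * m + 1)
    (hdn : (⟨d, idx_lt hd⟩ : Fin (2 * d)) ∉ s) (hbad : ¬ Good hd ℓ I s) :
    ∃ t, t <:+ s ∧ gr B S1 0 ^ K / 2 ^ ℓ ≤ Z B S1 ⟨0, by omega⟩ t := by
  have hg := one_lt_gr hB hBS
  have hfin : ∀ t : List (Fin (2 * d)), gr B S1 0 ^ K ≤ Q B S1 t → t.count ⟨0, by omega⟩ ≤ ℓ →
      gr B S1 0 ^ K / 2 ^ ℓ ≤ Z B S1 ⟨0, by omega⟩ t := by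
    intro t h1 h2
    unfold Z
    rw [div_eq_mul_inv, ← inv_pow, ← one_div]
    apply mul_le_mul h1 _ (by positivity) (by linarith [Q_one hB hBS t])
    exact pow_le_pow_of_le_one (by norm_num) (by norm_num) h2
  have hdist : ∀ t : List (Fin (2 * d)), K ≤ (vis t).toFinset.card → gr B S1 0 ^ K ≤ Q B S1 t :=
    fun t ht => (pow_le_pow_right₀ (hg 0).le ht).trans (Q_distinct hB hBS t)
  by_cases hall : ∃ u, u <:+ s ∧ ¬ (pos u ∈ I)
  · obtain ⟨t, ht, h1, h2⟩ := first_suffix (fun u => pos u ∈ I) s hall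
    refine ⟨t, ht, ?_⟩
    have hdt : (⟨d, idx_lt hd⟩ : Fin (2 * d)) ∉ t := fun h => hdn (ht.subset h)
    have hh := pos_height hd t hdt
    have hlt : ¬ (ℓ : ℤ) ≤ pos t ⟨0, by omega⟩ := fun h => hbad ⟨t, ht, h, h1, h2⟩
    apply hfin t _ (by omega)
    rcases hI2 _ h1 with h3 | h3 | ⟨j, h3⟩
    · exact absurd h3 hlt
    · omega
    · apply hdist
      have := (pos_lateral t j).2
      omega
  · push Not at hall
    refine ⟨s, List.suffix_rfl, ?_⟩
    have hh := pos_height hd s hdn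
    have := hI _ (hall s List.suffix_rfl)
    apply hfin s _ (by omega)
    by_cases hN : K ≤ (vis s).toFinset.card
    · exact hdist s hN
    · have : ∃ x, m ≤ (vis s).count x := by
        by_contra hcon
        push Not at hcon
        have e := List.sum_toFinset_count_eq_length (vis s)
        have h4 : ∑ x ∈ (vis s).toFinset, (vis s).count x ≤ (vis s).toFinset.card * m := by
          rw [← smul_eq_mul]
          exact Finset.sum_le_card_nsmul _ _ _ fun x _ => (hcon x).le
        rw [e, vis_length, hs] at h4
        have : (vis s).toFinset.card * m ≤ K * m := Nat.mul_le_mul_right _ (by omega)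
        omega
      obtain ⟨x, hx⟩ := this
      refine hm.trans (le_trans ?_ (Q_site hB hBS s x))
      exact Finset.prod_le_prod_of_subset_of_one_le (Finset.range_mono hx)
        (fun j _ => by linarith [hg j]) (fun j _ _ => (hg j).le)

lemma main_comb {d : ℕ} (hd : 1 ≤ d) {B S1 : ℝ} (hB : 0 < B) (hBS : B ≤ S1) (ℓ K m : ℕ)
    (hℓ : 1 ≤ ℓ) (hΛ : 1 ≤ gr B S1 0 ^ K / 2 ^ ℓ)
    (hm : gr B S1 0 ^ K ≤ ∏ j ∈ Finset.range m, gr B S1 j) (I : Set (V d))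
    (hI : ∀ x ∈ I, x ⟨0, by omega⟩ < (ℓ : ℤ))
    (hI2 : ∀ x, x ∉ I → (ℓ : ℤ) ≤ x ⟨0, by omega⟩ ∨ x ⟨0, by omega⟩ ≤ -(ℓ : ℤ) ∨ ∃ j, (K : ℤ) ≤ |x j|)
    {β : Fin (2 * d) → ℝ} (hβ : ∀ i, 0 < β i)
    (hu : β ⟨0, by omega⟩ = B) (hS1 : ∑ i, β i ≤ S1) :
    ∑ s ∈ (paths d (K * m + 1)).filter (fun s => ¬ Good hd ℓ I s), W β s ≤
      1 / (gr B S1 0 ^ K / 2 ^ ℓ) + ((K * m + 1 : ℕ) : ℝ) * (β ⟨d, idx_lt hd⟩ / B) := by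
  set n := K * m + 1 with hn
  have h1 := ville hB hBS hβ hu hS1 hΛ n
    (fun s => (⟨d, idx_lt hd⟩ : Fin (2 * d)) ∉ s ∧ ¬ Good hd ℓ I s) (by
      intro s hs h
      exact bad_cross hd hB hBS ℓ K m hℓ hm I hI hI2 s (mem_paths.mp hs) h.1 h.2)
  have h2 := down_bound hβ ⟨0, by omega⟩ (⟨d, idx_lt hd⟩ : Fin (2 * d)) n
  rw [hu] at h2
  refine le_trans ?_ (add_le_add h1 h2)
  rw [Finset.sum_filter, Finset.sum_filter, Finset.sum_filter, ← Finset.sum_add_distrib]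
  apply Finset.sum_le_sum
  intro s _
  have := W_nonneg hβ s
  by_cases a : (⟨d, idx_lt hd⟩ : Fin (2 * d)) ∈ s <;> by_cases b : Good hd ℓ I s <;> simp [a, b, this]

lemma prod_upd {ι : Type*} (F : Finset ι) (f g : ι → ℝ) (y : ι) (hy : y ∈ F) (c : ℝ)
    (h1 : ∀ x ∈ F, x ≠ y → f x = g x) (h2 : f y = g y * c) :
    ∏ x ∈ F, f x = (∏ x ∈ F, g x) * c := by
  rw [← Finset.mul_prod_erase F f hy, ← Finset.mul_prod_erase F g hy, h2,
    Finset.prod_congr rfl (fun x hx => h1 x (Finset.mem_of_mem_erase hx) (Finset.ne_of_mem_erase hx))]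
  ring

/-- Quenched weight of a path. -/
noncomputable def Qw {d : ℕ} (ω : Env d) : List (Fin (2 * d)) → ℝ
  | [] => 1
  | (i :: s) => Qw ω s * (ω (pos s)).1 i

lemma Qw_nonneg {d : ℕ} (ω : Env d) (s : List (Fin (2 * d))) : 0 ≤ Qw ω s := by
  induction s with
  | nil => simp [Qw]
  | cons i s ih => exact mul_nonneg ih ((ω (pos s)).2.1 i)

lemma Qw_eq {d : ℕ} (ω : Env d) (s : List (Fin (2 * d))) (F : Finset (V d))
    (hF : ∀ x ∈ vis s, x ∈ F) :
    Qw ω s = ∏ x ∈ F, ∏ i, (ω x).1 i ^ (edg s).count (x, i) := by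
  induction s with
  | nil => simp [Qw, edg]
  | cons i s ih =>
    have hF' : ∀ x ∈ vis s, x ∈ F := fun x hx => hF x (by simp [vis, hx])
    have hp : pos s ∈ F := hF _ (by simp [vis])
    rw [Qw, ih hF']
    symm
    apply prod_upd F _ _ (pos s) hp
    · intro x _ hx
      apply Finset.prod_congr rfl
      intro j _
      rw [edg, List.count_cons_of_ne]
      intro h
      exact hx (congrArg Prod.fst h).symm
    · apply prod_upd Finset.univ _ _ i (Finset.mem_univ _)
      · intro j _ hj
        rw [edg, List.count_cons_of_ne]
        intro h
        exact hj (congrArg Prod.snd h).symm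
      · rw [edg, List.count_cons_self, pow_succ]

lemma W_eq {d : ℕ} {β : Fin (2 * d) → ℝ} (s : List (Fin (2 * d)))
    (F : Finset (V d)) (hF : ∀ x ∈ vis s, x ∈ F) :
    W β s = ∏ x ∈ F, (∏ i, rf (β i) ((edg s).count (x, i))) /
      rf (∑ i, β i) (∑ i, (edg s).count (x, i)) := by
  induction s with
  | nil => simp [W, edg, rf]
  | cons i s ih =>
    have hF' : ∀ x ∈ vis s, x ∈ F := fun x hx => hF x (by simp [vis, hx])
    have hp : pos s ∈ F := hF _ (by simp [vis])
    rw [W, ih hF']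
    symm
    have hne : ∀ x, x ≠ pos s → ∀ j, (edg (i :: s)).count (x, j) = (edg s).count (x, j) := by
      intro x hx j
      rw [edg, List.count_cons_of_ne]
      intro h
      exact hx (congrArg Prod.fst h).symm
    apply prod_upd F _ _ (pos s) hp
    · intro x _ hx
      simp only [hne x hx]
    · have h1 : ∏ j, rf (β j) ((edg (i :: s)).count (pos s, j)) =
          (∏ j, rf (β j) ((edg s).count (pos s, j))) * (β i + (edg s).count (pos s, i)) := by
        apply prod_upd Finset.univ _ _ i (Finset.mem_univ _)
        · intro j _ hj
          rw [edg, List.count_cons_of_ne]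
          intro h
          exact hj (congrArg Prod.snd h).symm
        · rw [edg, List.count_cons_self, rf]
      rw [h1, count_edg, count_edg, pr, vis, List.count_cons_self, rf, mul_div_mul_comm]

lemma iid_prod {d : ℕ} {ℙ : Measure (Env d)} {μ : Measure (Simplex d)} (h : IsIIDWith d ℙ μ)
    (F : Finset (V d)) (g : V d → Simplex d → ℝ) (hg : ∀ x, Measurable (g x)) :
    ∫ ω, ∏ x ∈ F, g x (ω x) ∂ℙ = ∏ x ∈ F, ∫ p, g x p ∂μ := by
  obtain ⟨h1, h2, h3⟩ := h
  have hm : Measurable (fun (ω : Env d) (x : F) => ω x.1) := by fun_prop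
  have hmap : ℙ.map (fun (ω : Env d) (x : F) => ω x.1) = Measure.pi (fun _ : F => μ) := by
    symm
    apply Measure.pi_eq
    intro A hA
    rw [Measure.map_apply hm (MeasurableSet.univ_pi hA)]
    have := h3 F (fun x => if hx : x ∈ F then A ⟨x, hx⟩ else Set.univ) (by
      intro x; split_ifs
      · exact hA _
      · exact MeasurableSet.univ)
    have e : (fun (ω : Env d) (x : F) => ω x.1) ⁻¹' Set.univ.pi A =
      {ω | ∀ x ∈ F, ω x ∈ (if hx : x ∈ F then A ⟨x, hx⟩ else Set.univ)} := by
      ext ω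
      simp only [Set.mem_preimage, Set.mem_pi, Set.mem_univ, forall_true_left, Set.mem_ofPred_eq]
      constructor
      · intro hh x hx
        rw [dif_pos hx]; exact hh ⟨x, hx⟩
      · rintro hh ⟨x, hx⟩
        have := hh x hx
        rwa [dif_pos hx] at this
    rw [e, this, ← Finset.prod_coe_sort F]
    apply Finset.prod_congr rfl
    rintro ⟨x, hx⟩ _
    simp [hx]
  have e2 : (fun ω : Env d => ∏ x ∈ F, g x (ω x)) = fun ω : Env d =>
      (fun q : F → Simplex d => ∏ x : F, g x.1 (q x)) (fun x : F => ω x.1) := by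
    funext ω
    exact (Finset.prod_coe_sort F (fun x => g x (ω x))).symm
  rw [e2, ← integral_map (φ := fun (ω : Env d) (x : F) => ω x.1)
    (f := fun q : F → Simplex d => ∏ x : F, g x.1 (q x)) hm.aemeasurable, hmap]
  · rw [integral_fintype_prod_eq_prod (μ := fun _ : F => μ) (f := fun x : F => g x.1)]
    exact Finset.prod_coe_sort F (fun x => ∫ p, g x p ∂μ)
  · apply Measurable.aestronglyMeasurable
    apply Finset.measurable_prod
    intro x _
    exact (hg _).comp (measurable_pi_apply x)

lemma Qw_meas {d : ℕ} (s : List (Fin (2 * d))) : Measurable (fun ω : Env d => Qw ω s) := by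
  induction s with
  | nil => simp only [Qw]; exact measurable_const
  | cons i s ih =>
    simp only [Qw]
    exact ih.mul ((simplex_meas i).comp (measurable_pi_apply (pos s)))

lemma Qw_int {d : ℕ} {ℙ : Measure (Env d)} {μ : Measure (Simplex d)} (h : IsIIDWith d ℙ μ)
    {β : Fin (2 * d) → ℝ} (hβ : ∀ i, 0 < β i) (hS : 0 < ∑ i, β i) (hD : IsDirichlet d μ β)
    (s : List (Fin (2 * d))) : ∫ ω, Qw ω s ∂ℙ = W β s := by
  have hF : ∀ x ∈ vis s, x ∈ (vis s).toFinset := fun x hx => List.mem_toFinset.2 hx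
  rw [W_eq s _ hF]
  simp_rw [fun ω => Qw_eq ω s _ hF]
  rw [iid_prod h (vis s).toFinset (fun x p => ∏ i, p.1 i ^ (edg s).count (x, i))]
  · apply Finset.prod_congr rfl
    intro x _
    exact dir_mom hβ hS hD _
  · intro x
    apply Finset.measurable_prod
    intro i _
    exact (simplex_meas i).pow_const _

/-- Position after `k` steps. -/
def posAt {d : ℕ} (s : List (Fin (2 * d))) (k : ℕ) : V d := pos (s.drop (s.length - k))

def Cyl {d : ℕ} (s : List (Fin (2 * d))) : Set (Traj d) := {f | ∀ k ≤ s.length, f k = posAt s k}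

lemma posAt_cons {d : ℕ} (i : Fin (2 * d)) (s : List (Fin (2 * d))) (k : ℕ) (hk : k ≤ s.length) :
    posAt (i :: s) k = posAt s k := by
  unfold posAt
  rw [List.length_cons, show s.length + 1 - k = (s.length - k) + 1 by omega, List.drop_succ_cons]

lemma posAt_length {d : ℕ} (s : List (Fin (2 * d))) : posAt s s.length = pos s := by
  simp [posAt]

lemma posAt_zero {d : ℕ} (s : List (Fin (2 * d))) : posAt s 0 = 0 := by
  simp [posAt, pos]

lemma trans_dir {d : ℕ} (ω : Env d) (y : V d) (i : Fin (2 * d)) :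
    trans d ω y (y + dir d i) = (ω y).1 i := by
  unfold trans
  rw [Finset.sum_eq_single i]
  · simp
  · intro j _ hj
    rw [if_neg]
    intro h
    exact hj (dir_inj (add_left_cancel h)).symm
  · simp

lemma Qw_trans {d : ℕ} (ω : Env d) (s : List (Fin (2 * d))) :
    ∏ k ∈ Finset.range s.length, trans d ω (posAt s k) (posAt s (k + 1)) = Qw ω s := by
  induction s with
  | nil => simp [Qw]
  | cons i s ih =>
    rw [List.length_cons, Finset.prod_range_succ, Qw, ← ih]
    congr 1
    · apply Finset.prod_congr rfl
      intro k hk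
      have := Finset.mem_range.1 hk
      rw [posAt_cons i s k (by omega), posAt_cons i s (k + 1) (by omega)]
    · rw [posAt_cons i s _ le_rfl, posAt_length]
      have : posAt (i :: s) (s.length + 1) = pos s + dir d i := by
        rw [← List.length_cons (a := i), posAt_length, pos]
      rw [this, trans_dir]

lemma Cyl_meas {d : ℕ} (s : List (Fin (2 * d))) : MeasurableSet (Cyl s) := by
  have : Cyl s = ⋂ k ∈ Finset.range (s.length + 1), (fun f : Traj d => f k) ⁻¹' {posAt s k} := by
    ext f
    simp [Cyl, Nat.lt_succ_iff]
  rw [this]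
  apply Finset.measurableSet_biInter
  intro k _
  exact (measurable_pi_apply k) (measurableSet_singleton _)

lemma Cyl_cons {d : ℕ} {i : Fin (2 * d)} {s : List (Fin (2 * d))} {f : Traj d}
    (h : f ∈ Cyl (i :: s)) : f ∈ Cyl s ∧ f (s.length + 1) = pos s + dir d i := by
  constructor
  · intro k hk
    rw [h k (by simp; omega), posAt_cons i s k hk]
  · rw [h (s.length + 1) (by simp), ← List.length_cons (a := i), posAt_length, pos]

lemma Cyl_inj {d : ℕ} (s t : List (Fin (2 * d))) (hl : s.length = t.length) (f : Traj d)
    (hs : f ∈ Cyl s) (ht : f ∈ Cyl t) : s = t := by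
  induction s generalizing t with
  | nil => simp at hl; exact (List.eq_nil_of_length_eq_zero hl.symm).symm
  | cons i s ih =>
    cases t with
    | nil => simp at hl
    | cons j t =>
      simp only [List.length_cons, Nat.add_right_cancel_iff] at hl
      obtain ⟨h1, h2⟩ := Cyl_cons hs
      obtain ⟨h3, h4⟩ := Cyl_cons ht
      have := ih t hl h1 h3
      subst this
      rw [h2] at h4
      rw [dir_inj (add_left_cancel h4)]

lemma Cyl_suffix {d : ℕ} {s t : List (Fin (2 * d))} {f : Traj d} (h : f ∈ Cyl s) (ht : t <:+ s) :
    f t.length = pos t := by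
  rw [h _ ht.length_le, posAt]
  congr 1
  rw [List.suffix_iff_eq_drop] at ht
  exact ht.symm

lemma Pq_Cyl {d : ℕ} {Pq : Env d → V d → Measure (Traj d)} (h : IsQuenchedLaw d Pq) (ω : Env d)
    (s : List (Fin (2 * d))) : Pq ω 0 (Cyl s) = ENNReal.ofReal (Qw ω s) := by
  have := h.1 ω 0
  have h2 := h.2 ω 0 s.length (posAt s)
  rw [posAt_zero, if_pos rfl, one_mul, Qw_trans] at h2
  rw [← h2, ENNReal.ofReal_toReal]
  · rfl
  · exact measure_ne_top _ _

lemma Qw_le_one {d : ℕ} (ω : Env d) (s : List (Fin (2 * d))) : Qw ω s ≤ 1 := by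
  induction s with
  | nil => simp [Qw]
  | cons i s ih => exact mul_le_one₀ ih ((ω (pos s)).2.1 i) (simplex_le_one _ _)

lemma ann_Cyl {d : ℕ} {ℙ : Measure (Env d)} {μ : Measure (Simplex d)} (h : IsIIDWith d ℙ μ)
    {β : Fin (2 * d) → ℝ} (hβ : ∀ i, 0 < β i) (hS : 0 < ∑ i, β i) (hD : IsDirichlet d μ β)
    {Pq : Env d → V d → Measure (Traj d)} (hq : IsQuenchedLaw d Pq)
    (hm : AEMeasurable (fun ω => Pq ω 0) ℙ) (s : List (Fin (2 * d))) :
    annealed d ℙ Pq 0 (Cyl s) = ENNReal.ofReal (W β s) := by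
  have := h.1
  rw [annealed, Measure.bind_apply (Cyl_meas s) hm]
  simp_rw [Pq_Cyl hq]
  rw [← Qw_int h hβ hS hD, ofReal_integral_eq_lintegral_ofReal]
  · apply Integrable.of_bound (Qw_meas s).aestronglyMeasurable 1
    filter_upwards with ω
    rw [Real.norm_of_nonneg (Qw_nonneg ω s)]
    exact Qw_le_one ω s
  · filter_upwards with ω
    exact Qw_nonneg ω s

lemma ann_bad {d : ℕ} (iu : Fin (2 * d)) {ℙ : Measure (Env d)} {μ : Measure (Simplex d)}
    (h : IsIIDWith d ℙ μ)
    {β : Fin (2 * d) → ℝ} (hβ : ∀ i, 0 < β i) (hS : 0 < ∑ i, β i) (hD : IsDirichlet d μ β)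
    {Pq : Env d → V d → Measure (Traj d)} (hq : IsQuenchedLaw d Pq)
    (n : ℕ) (G : List (Fin (2 * d)) → Prop) (E : Set (Traj d))
    (hE : ∀ f ∈ E, ∀ s, f ∈ Cyl s → ¬ G s) :
    (annealed d ℙ Pq 0 E).toReal ≤ ∑ s ∈ (paths d n).filter (fun s => ¬ G s), W β s := by
  have hP := h.1
  by_cases hm : AEMeasurable (fun ω => Pq ω 0) ℙ
  swap
  · rw [annealed, Measure.bind, Measure.map_of_not_aemeasurable hm, Measure.join_zero]
    simp only [Measure.coe_zero, Pi.zero_apply, ENNReal.toReal_zero]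
    exact Finset.sum_nonneg (fun s _ => W_nonneg hβ s)
  have hprob : IsProbabilityMeasure (annealed d ℙ Pq 0) := by
    constructor
    rw [annealed, Measure.bind_apply MeasurableSet.univ hm]
    have := hq.1
    simp
  set T : Set (Traj d) := ⋃ s ∈ (paths d n).filter G, Cyl s with hT
  have hTm : MeasurableSet T := Finset.measurableSet_biUnion _ (fun s _ => Cyl_meas s)
  have hET : E ⊆ Tᶜ := by
    intro f hf hfT
    simp only [hT, Set.mem_iUnion, Finset.mem_filter] at hfT
    obtain ⟨s, hs, hfs⟩ := hfT
    exact hE f hf s hfs hs.2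
  have hTv : (annealed d ℙ Pq 0).real T = ∑ s ∈ (paths d n).filter G, W β s := by
    rw [hT, measureReal_biUnion_finset]
    · apply Finset.sum_congr rfl
      intro s _
      rw [Measure.real, ann_Cyl h hβ hS hD hq hm, ENNReal.toReal_ofReal (W_nonneg hβ s)]
    · intro s hs t ht hst
      apply Set.disjoint_left.2
      intro f hfs hft
      apply hst
      simp only [Finset.coe_filter, Set.mem_ofPred_eq, mem_paths] at hs ht
      exact Cyl_inj s t (by omega) f hfs hft
    · intro s _
      exact Cyl_meas s
  have h1 : (annealed d ℙ Pq 0).real E ≤ (annealed d ℙ Pq 0).real Tᶜ := measureReal_mono hET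
  rw [probReal_compl_eq_one_sub hTm, hTv] at h1
  have h2 := W_sum hβ iu n
  rw [← Finset.sum_filter_add_sum_filter_not (paths d n) G] at h2
  have : (annealed d ℙ Pq 0 E).toReal = (annealed d ℙ Pq 0).real E := rfl
  rw [this]
  linarith

lemma good_exit {d : ℕ} (hd : 1 ≤ d) (ℓ : ℕ) (I : Set (V d)) (s : List (Fin (2 * d)))
    (hG : Good hd ℓ I s) (f : Traj d) (hf : f ∈ Cyl s) :
    (ℓ : ℝ) ≤ dotl d (e1 d) (f (exitTime d I f)) := by
  obtain ⟨t, hts, h1, h2, h3⟩ := hG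
  have hex : exitTime d I f = t.length := by
    unfold exitTime
    apply le_antisymm
    · apply Nat.sInf_le
      simp only [Set.mem_ofPred_eq]
      rw [Cyl_suffix hf hts]; exact h2
    · apply le_csInf
      · exact ⟨t.length, by simp only [Set.mem_ofPred_eq]; rw [Cyl_suffix hf hts]; exact h2⟩
      · intro k hk
        by_contra hlt
        push Not at hlt
        apply hk
        have hu : t.drop (t.length - k) <:+ t := List.drop_suffix _ _
        have hul : (t.drop (t.length - k)).length = k := by simp; omega
        have := h3 _ hu (by intro he; rw [he] at hul; omega)
        rw [← Cyl_suffix hf (hu.trans hts), hul] at this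
        exact this
  rw [hex, Cyl_suffix hf hts, dotl, Finset.sum_eq_single ⟨0, by omega⟩]
  · simp only [e1, if_true, mul_one]
    exact_mod_cast h1
  · intro j _ hj
    have : (j : ℕ) ≠ 0 := fun hh => hj (Fin.ext hh)
    simp [e1, this]
  · simp

lemma choose_ell (lam C0 M : ℝ) (hl : 1 < lam) :
    ∃ ℓ : ℕ, 2 ≤ ℓ ∧ C0 ≤ ℓ ∧ 4 ≤ lam ^ ℓ ∧ 1 / (2 : ℝ) ^ ℓ ≤ (1 / 2) * (1 / (ℓ : ℝ) ^ M) := by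
  have h1 : ∀ᶠ ℓ : ℕ in atTop, 2 ≤ ℓ := eventually_ge_atTop 2
  have h2 : ∀ᶠ ℓ : ℕ in atTop, C0 ≤ (ℓ : ℝ) := tendsto_natCast_atTop_atTop.eventually_ge_atTop C0
  have h3 : ∀ᶠ ℓ : ℕ in atTop, 4 ≤ lam ^ ℓ :=
    (tendsto_pow_atTop_atTop_of_one_lt hl).eventually_ge_atTop 4
  have h4 : Tendsto (fun ℓ : ℕ => (ℓ : ℝ) ^ M * Real.exp (-(Real.log 2) * (ℓ : ℝ))) atTop (𝓝 0) :=
    (tendsto_rpow_mul_exp_neg_mul_atTop_nhds_zero M (Real.log 2)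
      (Real.log_pos (by norm_num))).comp tendsto_natCast_atTop_atTop
  have h5 := h4.eventually_le_const (show (0 : ℝ) < 1 / 2 by norm_num)
  obtain ⟨ℓ, a, b, c, e⟩ := (h1.and (h2.and (h3.and h5))).exists
  refine ⟨ℓ, a, b, c, ?_⟩
  have hp : (0 : ℝ) < (ℓ : ℝ) ^ M := Real.rpow_pos_of_pos (by exact_mod_cast (by omega : 0 < ℓ)) M
  have he : Real.exp (-(Real.log 2) * (ℓ : ℝ)) = 1 / (2 : ℝ) ^ ℓ := by
    rw [neg_mul, Real.exp_neg, mul_comm, Real.exp_nat_mul, Real.exp_log (by norm_num), one_div]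
  rw [he] at e
  rw [← div_eq_mul_one_div, le_div_iff₀ hp]
  linarith

lemma choose_eps (n : ℕ) (u : Fin n → ℝ) (P : Fin n → Prop) (hu : ∀ i, P i → 0 < u i) (c : ℝ)
    (hc : 0 < c) : ∃ ε : ℝ, 0 < ε ∧ ε < 1 ∧ ε ≤ c ∧ ∀ i, P i → ε ≤ u i := by
  have h : ∀ᶠ ε in 𝓝[>] (0 : ℝ), 0 < ε ∧ ε < 1 ∧ ε ≤ c ∧ ∀ i, P i → ε ≤ u i := by
    have key : ∀ a : ℝ, 0 < a → ∀ᶠ ε in 𝓝[>] (0 : ℝ), ε < a := fun a ha =>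
      nhdsWithin_le_nhds (eventually_lt_nhds ha)
    have k0 : ∀ᶠ ε in 𝓝[>] (0 : ℝ), 0 < ε := eventually_mem_nhdsWithin
    refine k0.and ((key 1 one_pos).and (((key c hc).mono fun _ h => h.le).and ?_))
    rw [eventually_all]
    intro i
    by_cases hP : P i
    · exact (key _ (hu i hP)).mono fun _ h _ => h.le
    · exact Eventually.of_forall fun _ h => absurd h hP
  exact h.exists

/-- **Theorem (Dirichlet environments satisfy the polynomial condition).**
Let `β₁,…,β_d, β_{d+2},…,β_{2d}` be fixed positive numbers and `M ≥ 15d+5`. There exists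
`ε ∈ (0,1)` such that if `0 < β_{1+d} ≤ ε`, the random walk in the i.i.d. Dirichlet
environment with parameters `(β₁,…,β_{2d})` satisfies `(P)_M|e₁` on a box of size
`L ≥ c₀`. -/
theorem dirichlet_poly_cond
    (d : ℕ) (hd : 1 ≤ d)
    (M : ℝ) (hM : 15 * d + 5 ≤ M)
    (βo : Fin (2 * d) → ℝ)
    (hβo : ∀ i : Fin (2 * d), i ≠ ⟨d, by omega⟩ → 0 < βo i) :
    ∃ ε : ℝ, 0 < ε ∧ ε < 1 ∧
      ∀ b : ℝ, 0 < b → b ≤ ε →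
        ∀ (ℙ : Measure (Env d)) (μ : Measure (Simplex d))
          (Pq : Env d → V d → Measure (Traj d)),
          IsQuenchedLaw d Pq → IsIIDWith d ℙ μ →
          IsDirichlet d μ (Function.update βo ⟨d, by omega⟩ b) →
          ∃ L : ℝ, 2 ≤ L ∧ c0 d ℙ ≤ L ∧ PolyCond d ℙ Pq (e1 d) M L := by
  have h0d : (⟨0, by omega⟩ : Fin (2 * d)) ≠ ⟨d, by omega⟩ := by
    intro h; rw [Fin.ext_iff] at h; simp at h; omega
  set B := βo ⟨0, by omega⟩ with hBdef
  have hB : 0 < B := hβo _ h0d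
  set S0 := ∑ i ∈ Finset.univ.erase (⟨d, by omega⟩ : Fin (2 * d)), βo i with hS0
  set S1 := S0 + 1 with hS1def
  have hBS : B ≤ S1 := by
    have : B ≤ S0 := Finset.single_le_sum (f := βo)
      (fun i hi => (hβo i (Finset.ne_of_mem_erase hi)).le)
      (Finset.mem_erase.2 ⟨h0d, Finset.mem_univ _⟩)
    linarith
  obtain ⟨ℓ, hℓ2, hℓC, hℓ4, hℓM⟩ := choose_ell (gr B S1 0)
    ((2/3)*(3:ℝ)^(120*(d:ℝ)^4 + 3000*(d:ℝ)*(Real.log (2*Real.exp (S1/2)))^2)) M (one_lt_gr hB hBS 0)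
  obtain ⟨m, hm⟩ := gr_prod hB hBS (gr B S1 0 ^ (ℓ ^ 2))
  have hℓpos : (0 : ℝ) < ℓ := by exact_mod_cast (by omega : 0 < ℓ)
  have hLM : (0 : ℝ) < (ℓ : ℝ) ^ M := Real.rpow_pos_of_pos hℓpos M
  have hn : (0 : ℝ) < ((ℓ ^ 2 * m + 1 : ℕ) : ℝ) := by exact_mod_cast Nat.succ_pos _
  obtain ⟨ε, he0, he1, hec, heβ⟩ := choose_eps (2 * d) βo (fun i => i ≠ ⟨d, by omega⟩) hβo
    ((1 / 2) * (1 / (ℓ : ℝ) ^ M) * B / ((ℓ ^ 2 * m + 1 : ℕ) : ℝ)) (by positivity)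
  refine ⟨ε, he0, he1, ?_⟩
  intro b hb hbe ℙ μ Pq hq hI hD
  set β := Function.update βo ⟨d, by omega⟩ b with hβdef
  have hβd : β ⟨d, by omega⟩ = b := Function.update_self ..
  have hβne : ∀ i, i ≠ ⟨d, by omega⟩ → β i = βo i := fun i hi => Function.update_of_ne hi ..
  have hβ : ∀ i, 0 < β i := by
    intro i
    by_cases hi : i = ⟨d, by omega⟩
    · rw [hi, hβd]; exact hb
    · rw [hβne i hi]; exact hβo i hi
  have hmin : ∀ i, β ⟨d, by omega⟩ ≤ β i := by
    intro i
    by_cases hi : i = ⟨d, by omega⟩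
    · rw [hi]
    · rw [hβne i hi, hβd]; exact hbe.trans (heβ i hi)
  have hsum : ∑ i, β i ≤ S1 := by
    rw [← Finset.add_sum_erase _ _ (Finset.mem_univ (⟨d, by omega⟩ : Fin (2 * d))), hβd,
      Finset.sum_congr rfl (fun i hi => hβne i (Finset.ne_of_mem_erase hi))]
    linarith
  have hS : 0 < ∑ i, β i := Finset.sum_pos (fun i _ => hβ i) ⟨⟨0, by omega⟩, Finset.mem_univ _⟩
  refine ⟨ℓ, by exact_mod_cast hℓ2, ?_, ?_⟩
  · exact (c0_bound hβ ⟨d, by omega⟩ ⟨0, by omega⟩ h0d hmin (by rw [hβd]; linarith) S1 hsum hI hD).trans hℓC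
  · have hℓ1 : (1 : ℝ) ≤ ℓ := by exact_mod_cast (by omega : 1 ≤ ℓ)
    refine ⟨(ℓ : ℝ) ^ 2, by positivity, ?_, LinearEquiv.refl ℝ _, ?_, rfl, ?_⟩
    · nlinarith [sq_nonneg (ℓ : ℝ)]
    · refine ⟨fun u v => rfl, ?_⟩
      exact LinearMap.det_id
    · have hgr : 2 ^ ℓ ≤ gr B S1 0 ^ (ℓ ^ 2) / 2 ^ ℓ := by
        rw [le_div_iff₀ (by positivity), ← mul_pow, sq, pow_mul]
        exact pow_le_pow_left₀ (by norm_num) (by linarith) ℓ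
      have hgr1 : 1 ≤ gr B S1 0 ^ (ℓ ^ 2) / 2 ^ ℓ := (one_le_pow₀ (by norm_num)).trans hgr
      have hbox : ∀ x : V d, x ∈ box d (LinearEquiv.refl ℝ _) (ℓ : ℝ) ((ℓ : ℝ) ^ 2) ↔
          ∀ j : Fin d, if (j : ℕ) = 0 then -(ℓ : ℤ) < x j ∧ x j < ℓ
            else -((ℓ : ℤ) ^ 2) < x j ∧ x j < (ℓ : ℤ) ^ 2 := by
        intro x
        apply forall_congr'
        intro j
        simp only [LinearEquiv.refl_symm, LinearEquiv.refl_apply, toR]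
        split_ifs
        · constructor <;> (rintro ⟨p, q⟩; exact ⟨by exact_mod_cast p, by exact_mod_cast q⟩)
        · constructor <;> (rintro ⟨p, q⟩; exact ⟨by exact_mod_cast p, by exact_mod_cast q⟩)
      have hmain := main_comb hd hB hBS ℓ (ℓ ^ 2) m (by omega) hgr1 hm
        (box d (LinearEquiv.refl ℝ _) (ℓ : ℝ) ((ℓ : ℝ) ^ 2))
        (by
          intro x hx
          have := (hbox x).1 hx ⟨0, by omega⟩
          simp only [if_true] at this
          exact this.2)
        (by
          intro x hx
          rw [hbox] at hx
          push Not at hx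
          obtain ⟨j, hj⟩ := hx
          by_cases hj0 : (j : ℕ) = 0
          · have hjz : j = ⟨0, by omega⟩ := Fin.ext hj0
            rw [if_pos hj0, hjz] at hj
            by_cases hlt : -(ℓ : ℤ) < x ⟨0, by omega⟩
            · left
              by_contra hcon
              exact hj ⟨hlt, not_le.1 hcon⟩
            · right; left; exact not_lt.1 hlt
          · right; right
            refine ⟨j, ?_⟩
            rw [if_neg hj0] at hj
            by_contra hcon
            push Not at hcon
            push_cast at hcon
            exact hj (abs_lt.1 hcon))
        hβ (hβne _ h0d) hsum
      refine (ann_bad ⟨0, by omega⟩ hI hβ hS hD hq (ℓ ^ 2 * m + 1)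
        (Good hd ℓ (box d (LinearEquiv.refl ℝ _) (ℓ : ℝ) ((ℓ : ℝ) ^ 2))) _ ?_).trans
        (hmain.trans ?_)
      · intro f hf s hfs hG
        exact absurd (good_exit hd ℓ _ s hG f hfs) (not_le.2 hf)
      · have t1 : 1 / (gr B S1 0 ^ (ℓ ^ 2) / 2 ^ ℓ) ≤ (1 / 2) * (1 / (ℓ : ℝ) ^ M) :=
          (one_div_le_one_div_of_le (by positivity) hgr).trans hℓM
        have t2 : ((ℓ ^ 2 * m + 1 : ℕ) : ℝ) * (β ⟨d, by omega⟩ / B) ≤ (1 / 2) * (1 / (ℓ : ℝ) ^ M) := by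
          rw [hβd]
          have := hbe.trans hec
          rw [le_div_iff₀ hn] at this
          rw [← mul_div_assoc, div_le_iff₀ hB]
          linarith
        linarith

end RWRE
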